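/- arXiv:0808.2705 — 14 statements merged into one kernel-verified Lean document; each statement's English description precedes it below -/
import Mathlib

section
/- Let R be a Riesz space with a distinguished element 1. For every a ∈ R and all rationals p, q, t, s with t < s one has ((a − p • 1) ⊓ (q • 1 − a)) ⊓ (((s − t)/2) • 1) ≤ ((a − p • 1) ⊓ (s • 1 − a)) ⊔ ((a − t • 1) ⊓ (q • 1 − a)). -/
/-- In a Riesz space with distinguished element `one`, for every `a`
and rationals `p, q, t, s` with `t < s`:
`((a - p•1) ⊓ (q•1 - a)) ⊓ (((s - t)/2)•1) ≤ ((a - p•1) ⊓ (s•1 - a)) ⊔ ((a - t•1) ⊓ (q•1 - a))`. -/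
theorem stone_yosida_stmt1 {R : Type*} [Lattice R] [AddCommGroup R] [Module ℚ R]
    [CovariantClass R R (· + ·) (· ≤ ·)] [PosSMulMono ℚ R]
    (one : R) (a : R) (p q t s : ℚ) (hts : t < s) :
    ((a - p • one) ⊓ (q • one - a)) ⊓ (((s - t) / 2) • one) ≤
      ((a - p • one) ⊓ (s • one - a)) ⊔ ((a - t • one) ⊓ (q • one - a)) := by
  have : AddLeftMono R := ‹CovariantClass R R (· + ·) (· ≤ ·)›
  have midpoint_le : ((s - t) / 2) • one ≤ (s • one - a) ⊔ (a - t • one) := by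
    set m := (s • one - a) ⊔ (a - t • one)
    have hsum : (s • one - a) + (a - t • one) ≤ m + m :=
      add_le_add le_sup_left le_sup_right
    calc ((s - t) / 2) • one = (1 / 2 : ℚ) • ((s • one - a) + (a - t • one)) := by module
      _ ≤ (1 / 2 : ℚ) • (m + m) := smul_le_smul_of_nonneg_left hsum (by norm_num)
      _ = m := by module
  have inf_sup (x y z : R) : x ⊓ (y ⊔ z) = x ⊓ y ⊔ x ⊓ z :=
    @inf_sup_left R (AddCommGroup.toDistribLattice R) x y z
  refine (inf_le_inf_left _ midpoint_le).trans ?_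
  rw [inf_sup]
  exact sup_le_sup (inf_le_inf_right _ inf_le_left)
    (le_inf inf_le_right (inf_le_left.trans inf_le_right))
end

section
/- Let R be a Riesz space with strong unit 1, let b, c ∈ R with 0 ≤ b and 0 ≤ c, and let ε be a rational with ε > 0. If (ε • 1) ⊓ b ≤ c, then there exists n ∈ ℕ with b ≤ n • c. -/
/-- In a Riesz space with strong unit `one`, if `0 ≤ b`, `0 ≤ c`,
`ε > 0` is rational and `(ε • 1) ⊓ b ≤ c`, then `b ≤ n • c` for some `n ∈ ℕ`. -/
theorem stone_yosida_stmt2 {R : Type*} [Lattice R] [AddCommGroup R] [Module ℚ R]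
    [CovariantClass R R (· + ·) (· ≤ ·)] [PosSMulMono ℚ R]
    (one : R) (hone : 0 ≤ one) (hstrong : ∀ a : R, ∃ n : ℕ, a ≤ n • one)
    (b c : R) (hb : 0 ≤ b) (hc : 0 ≤ c) (ε : ℚ) (hε : 0 < ε)
    (h : (ε • one) ⊓ b ≤ c) :
    ∃ n : ℕ, b ≤ n • c := by
  have : IsOrderedAddMonoid R :=
    { add_le_add_left := fun a b hab c => by
        rw [add_comm a c, add_comm b c]
        exact CovariantClass.elim c hab }
  obtain ⟨m, hm⟩ := hstrong b
  obtain ⟨k, hk⟩ := exists_nat_gt ((m : ℚ) / ε)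
  have hk0 : (0 : ℚ) < k := lt_of_le_of_lt (by positivity) hk
  have hmk : (k : ℚ)⁻¹ * m ≤ ε := by
    rw [inv_mul_le_iff₀ hk0]
    exact ((div_lt_iff₀ hε).1 hk).le
  have hk1 : (k : ℚ)⁻¹ ≤ 1 := inv_le_one_of_one_le₀ (by
    exact_mod_cast Nat.one_le_iff_ne_zero.2 (by rintro rfl; simp at hk0))
  have smul_mono : ∀ {p q : ℚ} {x : R}, p ≤ q → 0 ≤ x → p • x ≤ q • x := by
    intro p q x hpq hx
    rw [← sub_nonneg, ← sub_smul]
    exact smul_nonneg (sub_nonneg.2 hpq) hx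
  have hle_one : (k : ℚ)⁻¹ • b ≤ ε • one := by
    refine (smul_le_smul_of_nonneg_left hm (inv_nonneg.2 hk0.le)).trans ?_
    rw [← Nat.cast_smul_eq_nsmul ℚ, smul_smul]
    exact smul_mono hmk hone
  have hle_b : (k : ℚ)⁻¹ • b ≤ b := by
    simpa using smul_mono hk1 hb
  refine ⟨k, ?_⟩
  have hle := smul_le_smul_of_nonneg_left ((le_inf hle_one hle_b).trans h) hk0.le
  rwa [smul_inv_smul₀ hk0.ne', Nat.cast_smul_eq_nsmul] at hle
end

section
/- Let R be a Riesz space with strong unit 1 and a ∈ R. Let p < q be rationals and let (p₀, q₀), …, (p_k, q_k) be finitely many rational open intervals covering (p, q), in the sense that for every rational x with p < x < q there is some i with pᵢ < x < qᵢ. If there exists N ∈ ℕ with 1 ≤ N • ((a − p • 1) ⊓ (q • 1 − a)), then there exists M ∈ ℕ with 1 ≤ M • (⨆_{i=0}^{k} ((a − pᵢ • 1) ⊓ (qᵢ • 1 − a))), where ⨆ denotes the finite lattice supremum. -/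
/-- A property of rationals that propagates along each interval of a finite family propagates
along any open interval covered by the family. -/
theorem chain_of_finite_cover {ι : Type*} [Fintype ι] {p q : ℚ} {ps qs : ι → ℚ} {P : ℚ → Prop}
    (hcov : ∀ x : ℚ, p < x → x < q → ∃ i, ps i < x ∧ x < qs i)
    (hstep : ∀ i c d, ps i < c → d < qs i → P c → P d) {c d : ℚ} (hpc : p < c) (hcq : c < q)
    (hdq : d < q) (hc : P c) : P d := by
  classical
  induction hn : (Finset.univ.filter fun i => c < qs i).card using Nat.strong_induction_on
    generalizing c with
  | _ n ih =>
    obtain ⟨i, hi, hi'⟩ := hcov c hpc hcq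
    by_cases hd : d < qs i
    · exact hstep i c d hi hd hc
    · have hq : qs i < q := (not_lt.1 hd).trans_lt hdq
      obtain ⟨j, hj, hj'⟩ := hcov (qs i) (hpc.trans hi') hq
      obtain ⟨e, he, he'⟩ := exists_between hj
      refine ih _ ?_ (hpc.trans hi') hq (hstep j e _ he hj' (hstep i c e hi he' hc)) rfl
      rw [← hn]
      refine Finset.card_lt_card (Finset.ssubset_iff_of_subset ?_ |>.2 ⟨i, ?_, ?_⟩)
      · exact Finset.monotone_filter_right _ fun _ _ hx => hi'.trans hx
      · simpa using hi'
      · simp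

theorem exists_rat_smul_le_of_le_nsmul {R : Type*} [Lattice R] [AddCommGroup R] [Module ℚ R]
    [PosSMulMono ℚ R] {e x : R} {N : ℕ} (hN : N ≠ 0) (h : e ≤ N • x) :
    (N : ℚ)⁻¹ • e ≤ x := by
  have hN' : (N : ℚ) ≠ 0 := Nat.cast_ne_zero.2 hN
  have := smul_le_smul_of_nonneg_left h (inv_nonneg.2 (Nat.cast_nonneg (α := ℚ) N))
  rwa [← Nat.cast_smul_eq_nsmul ℚ, inv_smul_smul₀ hN'] at this

section RieszSpace

variable {R : Type*} [Lattice R] [AddCommGroup R]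
  [CovariantClass R R (· + ·) (· ≤ ·)]

/-- If `u ≥ 0` and some multiple of `u` dominates `-x`, then `0 ≤ -u ⊔ x` forces `0 ≤ x`. -/
theorem nonneg_of_nonneg_neg_sup {u x : R} (hu : 0 ≤ u) {n : ℕ} (hn : -x ≤ n • u)
    (h : 0 ≤ -u ⊔ x) : 0 ≤ x := by
  let _ : DistribLattice R := AddCommGroup.toDistribLattice R
  have hy : 0 ≤ -u ⊔ (x ⊓ 0) := by
    rw [sup_inf_left]
    exact le_inf h le_sup_right
  have key : ∀ m : ℕ, 0 ≤ -(m • u) ⊔ (x ⊓ 0) := by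
    intro m
    induction m with
    | zero => simp
    | succ m ih =>
      have hadd := add_nonneg hy ih
      rw [sup_add, add_sup, add_sup] at hadd
      refine hadd.trans (sup_le (sup_le ?_ ?_) (sup_le ?_ ?_))
      · rw [succ_nsmul, neg_add_rev]
        exact le_sup_left
      · exact le_sup_of_le_right (add_le_of_nonpos_left (neg_nonpos.2 hu))
      · exact le_sup_of_le_right (add_le_of_nonpos_right (neg_nonpos.2 (nsmul_nonneg hu m)))
      · exact le_sup_of_le_right (add_le_of_nonpos_left inf_le_right)
  have hx := key n
  have hle : -(n • u) ≤ x := neg_le.1 hn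
  exact hx.trans (sup_le hle inf_le_left)

variable [Module ℚ R] [PosSMulMono ℚ R]

theorem rat_smul_le_smul {e : R} (he : 0 ≤ e) {c d : ℚ} (hcd : c ≤ d) : c • e ≤ d • e := by
  rw [← sub_nonneg, ← sub_smul]
  exact smul_nonneg (sub_nonneg.2 hcd) he

/-- If "`c • e ≤ a` or `ε • e ≤ s`" holds and `s` dominates the degree of membership of `a` in
`(l, r)` with `l < c` and `d < r`, then "`d • e ≤ a` or `ε' • e ≤ s`" holds for a smaller `ε'`. -/
theorem exists_nonneg_sup_step {e a s : R} (he : 0 ≤ e) {l r c d : ℚ}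
    (hs : (a - l • e) ⊓ (r • e - a) ≤ s) (hlc : l < c) (hdr : d < r)
    (h : ∃ ε : ℚ, 0 < ε ∧ 0 ≤ (a - c • e) ⊔ (s - ε • e)) :
    ∃ ε : ℚ, 0 < ε ∧ 0 ≤ (a - d • e) ⊔ (s - ε • e) := by
  let _ : DistribLattice R := AddCommGroup.toDistribLattice R
  obtain ⟨ε, hε, h⟩ := h
  obtain ⟨δ, hδ, hδε, hδl, hδr⟩ : ∃ δ : ℚ, 0 < δ ∧ δ ≤ ε ∧ l + δ ≤ c ∧ d + δ ≤ r := by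
    refine ⟨min ε (min (c - l) (r - d)), ?_, min_le_left _ _, ?_, ?_⟩
    · simp [hε, hlc, hdr]
    · linarith [min_le_right ε (min (c - l) (r - d)), min_le_left (c - l) (r - d)]
    · linarith [min_le_right ε (min (c - l) (r - d)), min_le_right (c - l) (r - d)]
  refine ⟨δ, hδ, ?_⟩
  have h₁ : 0 ≤ (s - δ • e) ⊔ (a - l • e - δ • e) := by
    refine h.trans (sup_le (le_sup_of_le_right ?_) (le_sup_of_le_left ?_))
    · rw [sub_sub, ← add_smul]
      exact sub_le_sub_left (rat_smul_le_smul he hδl) a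
    · exact sub_le_sub_left (rat_smul_le_smul he hδε) s
  have h₂ : 0 ≤ (a - d • e) ⊔ (r • e - a - δ • e) := by
    have hle : -(a - d • e) ≤ r • e - a - δ • e := by
      have := rat_smul_le_smul he hδr
      rw [add_smul] at this
      rw [neg_sub, sub_right_comm]
      exact sub_le_sub_right (le_sub_iff_add_le.2 this) a
    refine (abs_nonneg (a - d • e)).trans ?_
    exact sup_le_sup_left hle _
  have h₃ : (a - l • e - δ • e) ⊓ (r • e - a - δ • e) ≤ s - δ • e := by
    rw [le_sub_iff_add_le]
    refine le_trans (le_inf ?_ ?_) hs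
    · exact le_sub_iff_add_le.1 inf_le_left
    · exact le_sub_iff_add_le.1 inf_le_right
  calc (0 : R) ≤ ((a - d • e) ⊔ (s - δ • e) ⊔ (a - l • e - δ • e)) ⊓
        ((a - d • e) ⊔ (s - δ • e) ⊔ (r • e - a - δ • e)) := by
        refine le_inf (h₁.trans ?_) (h₂.trans ?_)
        · exact sup_le_sup_right le_sup_right _
        · exact sup_le_sup_right le_sup_left _
    _ = (a - d • e) ⊔ (s - δ • e) ⊔ (a - l • e - δ • e) ⊓ (r • e - a - δ • e) :=
        sup_inf_left .. |>.symm
    _ ≤ (a - d • e) ⊔ (s - δ • e) := sup_le le_rfl (h₃.trans le_sup_right)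

theorem exists_le_nsmul_of_rat_smul_le {e x : R} (he : 0 ≤ e) {ε : ℚ} (hε : 0 < ε)
    (h : ε • e ≤ x) : ∃ M : ℕ, e ≤ M • x := by
  obtain ⟨M, hM⟩ := exists_nat_ge ε⁻¹
  refine ⟨M, ?_⟩
  calc e = (1 : ℚ) • e := (one_smul _ _).symm
    _ ≤ ((M : ℚ) * ε) • e := rat_smul_le_smul he ((inv_le_iff_one_le_mul₀ hε).1 hM)
    _ = (M : ℚ) • ε • e := mul_smul _ _ _
    _ ≤ (M : ℚ) • x := smul_le_smul_of_nonneg_left h (Nat.cast_nonneg M)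
    _ = M • x := Nat.cast_smul_eq_nsmul ℚ M x

end RieszSpace

/-- In a Riesz space with strong unit, if rational open intervals
`(pᵢ, qᵢ)`, `i = 0, …, k`, cover `(p, q)` with `p < q`, and `1 ≤ N • ((a - p•1) ⊓ (q•1 - a))`
for some `N`, then `1 ≤ M • ⨆ᵢ ((a - pᵢ•1) ⊓ (qᵢ•1 - a))` for some `M`. -/
theorem stone_yosida_stmt3 {R : Type*} [Lattice R] [AddCommGroup R] [Module ℚ R]
    [CovariantClass R R (· + ·) (· ≤ ·)] [PosSMulMono ℚ R]
    (one : R) (hone : 0 ≤ one) (hstrong : ∀ a : R, ∃ n : ℕ, a ≤ n • one)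
    (a : R) (p q : ℚ) (hpq : p < q) (k : ℕ) (ps qs : Fin (k + 1) → ℚ)
    (hcov : ∀ x : ℚ, p < x → x < q → ∃ i, ps i < x ∧ x < qs i)
    (h : ∃ N : ℕ, one ≤ N • ((a - p • one) ⊓ (q • one - a))) :
    ∃ M : ℕ, one ≤ M • (Finset.univ.sup' Finset.univ_nonempty
      fun i => (a - ps i • one) ⊓ (qs i • one - a)) := by
  obtain ⟨N, hN⟩ := h
  rcases eq_or_ne N 0 with rfl | hN0
  · exact ⟨0, by simpa using hN⟩
  set s := Finset.univ.sup' Finset.univ_nonempty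
    fun i => (a - ps i • one) ⊓ (qs i • one - a) with hs
  have hsi : ∀ i, (a - ps i • one) ⊓ (qs i • one - a) ≤ s := fun i =>
    Finset.le_sup' (fun i => (a - ps i • one) ⊓ (qs i • one - a)) (Finset.mem_univ i)
  have hinf := exists_rat_smul_le_of_le_nsmul hN0 hN
  obtain ⟨t, ht, htN, htpq⟩ : ∃ t : ℚ, 0 < t ∧ 2 * t ≤ (N : ℚ)⁻¹ ∧ p + t < q := by
    have hNpos : (0 : ℚ) < (N : ℚ)⁻¹ := by positivity
    have hmin : 0 < min (N : ℚ)⁻¹ (q - p) := lt_min hNpos (sub_pos.2 hpq)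
    refine ⟨min (N : ℚ)⁻¹ (q - p) / 2, by positivity, ?_, ?_⟩
    · linarith [min_le_left (N : ℚ)⁻¹ (q - p)]
    · linarith [min_le_right (N : ℚ)⁻¹ (q - p)]
  have hinf' : (2 * t) • one ≤ (a - p • one) ⊓ (q • one - a) :=
    (rat_smul_le_smul hone htN).trans hinf
  have hlow : t • one ≤ a - p • one :=
    (rat_smul_le_smul hone (by linarith)).trans (hinf'.trans inf_le_left)
  have hup : (2 * t) • one ≤ q • one - a := hinf'.trans inf_le_right
  have hstart : ∃ ε : ℚ, 0 < ε ∧ 0 ≤ (a - (p + t) • one) ⊔ (s - ε • one) := by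
    refine ⟨1, one_pos, le_sup_of_le_left ?_⟩
    rwa [add_smul, ← sub_sub, sub_nonneg]
  obtain ⟨ε, hε, hend⟩ := chain_of_finite_cover
    (P := fun c => ∃ ε : ℚ, 0 < ε ∧ 0 ≤ (a - c • one) ⊔ (s - ε • one)) (d := q - t) hcov
    (fun i _ _ => exists_nonneg_sup_step hone (hsi i)) (by linarith) htpq (by linarith) hstart
  refine exists_le_nsmul_of_rat_smul_le hone hε (sub_nonneg.1 ?_)
  have hneg : a - (q - t) • one ≤ -(t • one) := by
    have hle : a ≤ q • one - (2 * t) • one := le_sub_comm.1 hup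
    rw [← sub_smul] at hle
    rw [sub_le_iff_le_add, ← neg_smul, ← add_smul]
    exact hle.trans_eq (by congr 1; ring)
  obtain ⟨n, hn⟩ := hstrong (t⁻¹ • -(s - ε • one))
  refine nonneg_of_nonneg_neg_sup (u := t • one) (n := n) (smul_nonneg ht.le hone) ?_
    (hend.trans (sup_le_sup_right hneg _))
  have := smul_le_smul_of_nonneg_left hn ht.le
  rwa [smul_inv_smul₀ ht.ne', smul_comm] at this
end

section
/- Let R be a Riesz space with strong unit 1 and let b₁, …, b_m ∈ R with m ≥ 1. If there exists N ∈ ℕ with 1 ≤ N • (b₁⁺ ⊔ … ⊔ b_m⁺), then there exist a rational r > 0 and M ∈ ℕ with 1 ≤ M • ((b₁ − r • 1)⁺ ⊔ … ⊔ (b_m − r • 1)⁺). -/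
/-- In a Riesz space with strong unit, if `1 ≤ N • (b₁⁺ ⊔ … ⊔ b_m⁺)` for
some `N ∈ ℕ` (with `m ≥ 1`), then there are a rational `r > 0` and `M ∈ ℕ` with
`1 ≤ M • ((b₁ - r•1)⁺ ⊔ … ⊔ (b_m - r•1)⁺)`, where `x⁺ = x ⊔ 0`. -/
theorem stone_yosida_stmt4 {R : Type*} [Lattice R] [AddCommGroup R] [Module ℚ R]
    [CovariantClass R R (· + ·) (· ≤ ·)] [PosSMulMono ℚ R]
    (one : R) (hone : 0 ≤ one) (hstrong : ∀ a : R, ∃ n : ℕ, a ≤ n • one)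
    (m : ℕ) (hm : 1 ≤ m) (b : Fin m → R)
    (h : ∃ N : ℕ, one ≤ N • (Finset.univ.sup' (Finset.univ_nonempty_iff.mpr ⟨⟨0, hm⟩⟩)
      fun i => b i ⊔ 0)) :
    ∃ r : ℚ, 0 < r ∧ ∃ M : ℕ,
      one ≤ M • (Finset.univ.sup' (Finset.univ_nonempty_iff.mpr ⟨⟨0, hm⟩⟩)
        fun i => (b i - r • one) ⊔ 0) := by
  have : IsOrderedAddMonoid R :=
    { add_le_add_left := fun a b hab c => by
        simpa [add_comm] using CovariantClass.elim (μ := (· + · : R → R → R)) c hab }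
  obtain ⟨N, hN⟩ := h
  have hr : (0 : ℚ) < 1 / (2 * (N + 1)) := by positivity
  set r : ℚ := 1 / (2 * (N + 1)) with hr_def
  refine ⟨r, hr, 2 * (N + 1), ?_⟩
  set S := Finset.univ.sup' (Finset.univ_nonempty_iff.mpr ⟨⟨0, hm⟩⟩) fun i => b i ⊔ 0
  set T := Finset.univ.sup' (Finset.univ_nonempty_iff.mpr ⟨⟨0, hm⟩⟩)
    fun i => (b i - r • one) ⊔ 0
  have hr_one : 0 ≤ r • one := smul_nonneg hr.le hone
  have hle (i : Fin m) : (b i - r • one) ⊔ 0 ≤ T :=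
    Finset.le_sup' (fun i => (b i - r • one) ⊔ 0) (Finset.mem_univ i)
  have hS_nonneg : 0 ≤ S :=
    le_sup_right.trans (Finset.le_sup' (fun i => b i ⊔ 0) (Finset.mem_univ ⟨0, hm⟩))
  have hT_nonneg : 0 ≤ T := le_sup_right.trans (hle ⟨0, hm⟩)
  have hST : S ≤ T + r • one := by
    refine Finset.sup'_le _ _ fun i _ => sup_le ?_ (add_nonneg hT_nonneg hr_one)
    exact sub_le_iff_le_add.mp (le_sup_left.trans (hle i))
  have hone_S : one ≤ (N + 1) • S :=
    hN.trans (nsmul_le_nsmul_left hS_nonneg N.le_succ)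
  have hr_smul : (2 * (N + 1)) • r • one = one := by
    rw [← Nat.cast_smul_eq_nsmul ℚ, smul_smul, hr_def]
    push_cast
    rw [mul_one_div_cancel (by positivity), one_smul]
  have key : one + one ≤ (2 * (N + 1)) • T + one :=
    calc one + one = 2 • one := (two_nsmul one).symm
      _ ≤ 2 • (N + 1) • S := nsmul_le_nsmul_right hone_S 2
      _ = (2 * (N + 1)) • S := by rw [← mul_nsmul']
      _ ≤ (2 * (N + 1)) • (T + r • one) := nsmul_le_nsmul_right hST _
      _ = (2 * (N + 1)) • T + one := by rw [nsmul_add, hr_smul]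
  exact le_of_add_le_add_right key
end

section
/- Let R be a Riesz space with strong unit 1 in which every element is normable. Then: (1) if Pos(a) and there exists n ∈ ℕ with a⁺ ≤ n • b⁺, then Pos(b); (2) if Pos(a ⊔ b), then Pos(a) or Pos(b); (3) for every rational r > 0 and every a ∈ R, either Pos(a) or a ≤ r • 1. -/
/-- `s : ℝ` is the supremum of `a` (relative to the unit `one`): for every rational `q`,
`s < q` iff `a ≤ q' • one` for some rational `q' < q`. -/
def IsSupAt {R : Type*} [Lattice R] [AddCommGroup R] [Module ℚ R]
    (one a : R) (s : ℝ) : Prop :=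
  ∀ q : ℚ, s < (q : ℝ) ↔ ∃ q' : ℚ, q' < q ∧ a ≤ q' • one

/-- `Pos a`: `a` is normable and its supremum is strictly positive. -/
def Pos {R : Type*} [Lattice R] [AddCommGroup R] [Module ℚ R]
    (one a : R) : Prop :=
  ∃ s : ℝ, IsSupAt one a s ∧ 0 < s

section SupremumPositivity

variable {R : Type*} [Lattice R] [AddCommGroup R] [Module ℚ R]
    [CovariantClass R R (· + ·) (· ≤ ·)] [PosSMulMono ℚ R] {one a : R}

theorem rat_smul_unit_mono (hone : 0 ≤ one) {p q : ℚ} (hpq : p ≤ q) :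
    p • one ≤ q • one := by
  have h : 0 ≤ (q - p) • one := smul_nonneg (sub_nonneg.2 hpq) hone
  rw [sub_smul] at h
  exact sub_nonneg.1 h

/-- A normable element that is not positive lies below every positive multiple of the unit. -/
theorem le_smul_unit_of_not_pos (hone : 0 ≤ one) (ha : ∃ s : ℝ, IsSupAt one a s)
    (hpos : ¬ Pos one a) {q : ℚ} (hq : 0 < q) : a ≤ q • one := by
  obtain ⟨s, hs⟩ := ha
  have hs0 : s ≤ 0 := not_lt.1 fun h => hpos ⟨s, hs, h⟩
  obtain ⟨p, hpq, hap⟩ := (hs q).1 (hs0.trans_lt (by exact_mod_cast hq))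
  exact hap.trans (rat_smul_unit_mono hone hpq.le)

end SupremumPositivity

/-- An element below every positive multiple of the unit is not positive. -/
theorem not_pos_of_forall_le_smul_unit {R : Type*} [Lattice R] [AddCommGroup R]
    [Module ℚ R] {one a : R} (h : ∀ q : ℚ, 0 < q → a ≤ q • one) :
    ¬ Pos one a := by
  rintro ⟨s, hs, hs0⟩
  obtain ⟨q, hq0, hqs⟩ := exists_rat_btwn hs0
  have hq : (0 : ℚ) < q := by exact_mod_cast hq0
  exact hqs.not_gt ((hs q).2 ⟨q / 2, half_lt_self hq, h _ (half_pos hq)⟩)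

/-- In a Riesz space with strong unit in which every element is normable:
(1) if `Pos a` and `a⁺ ≤ n • b⁺` for some `n ∈ ℕ`, then `Pos b`;
(2) if `Pos (a ⊔ b)`, then `Pos a` or `Pos b`;
(3) for every rational `r > 0` and every `a`, either `Pos a` or `a ≤ r • 1`. -/
theorem stone_yosida_stmt7 {R : Type*} [Lattice R] [AddCommGroup R] [Module ℚ R]
    [CovariantClass R R (· + ·) (· ≤ ·)] [PosSMulMono ℚ R]
    (one : R) (hone : 0 ≤ one) (hstrong : ∀ a : R, ∃ n : ℕ, a ≤ n • one)
    (hnorm : ∀ a : R, ∃ s : ℝ, IsSupAt one a s) :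
    (∀ a b : R, Pos one a → (∃ n : ℕ, a ⊔ 0 ≤ n • (b ⊔ 0)) → Pos one b) ∧
    (∀ a b : R, Pos one (a ⊔ b) → Pos one a ∨ Pos one b) ∧
    (∀ (r : ℚ) (a : R), 0 < r → Pos one a ∨ a ≤ r • one) := by
  refine ⟨?_, ?_, ?_⟩
  · rintro a b ha ⟨n, hn⟩
    by_contra hb
    refine not_pos_of_forall_le_smul_unit (fun q hq => ?_) ha
    have hn1 : (0 : ℚ) < n + 1 := by positivity
    have hp : 0 < q / (n + 1) := div_pos hq hn1
    have hb' : b ⊔ 0 ≤ (q / (n + 1)) • one :=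
      sup_le (le_smul_unit_of_not_pos hone (hnorm b) hb hp) (smul_nonneg hp.le hone)
    calc a ≤ a ⊔ 0 := le_sup_left
      _ ≤ n • (b ⊔ 0) := hn
      _ = (n : ℚ) • (b ⊔ 0) := (Nat.cast_smul_eq_nsmul ℚ n _).symm
      _ ≤ (n : ℚ) • (q / (n + 1)) • one :=
        smul_le_smul_of_nonneg_left hb' n.cast_nonneg
      _ = ((n : ℚ) * (q / (n + 1))) • one := smul_smul _ _ _
      _ ≤ q • one := by
        refine rat_smul_unit_mono hone ?_
        rw [← mul_div_assoc, div_le_iff₀ hn1]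
        nlinarith
  · intro a b hab
    by_contra! h
    exact not_pos_of_forall_le_smul_unit
      (fun q hq => sup_le (le_smul_unit_of_not_pos hone (hnorm a) h.1 hq)
        (le_smul_unit_of_not_pos hone (hnorm b) h.2 hq)) hab
  · intro r a hr
    by_cases h : Pos one a
    · exact Or.inl h
    · exact Or.inr (le_smul_unit_of_not_pos hone (hnorm a) h hr)
end

section
/- Let R be a Riesz space with strong unit 1 in which every element is normable, and let a₁, …, a_m ∈ R with m ≥ 1 be such that there exists N ∈ ℕ with 1 ≤ N • (a₁⁺ ⊔ … ⊔ a_m⁺). Then there is a nonempty subset S of {1, …, m} such that Pos(aᵢ) for every i ∈ S and there exists M ∈ ℕ with 1 ≤ M • (⨆_{i ∈ S} aᵢ⁺), where ⨆ denotes the finite lattice supremum over S. -/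
/-- If `0` is normable then the unit is not below `0`. -/
theorem IsSupAt.not_le_zero {R : Type*} [Lattice R] [AddCommGroup R] [Module ℚ R]
    {one : R} {s : ℝ} (hone : 0 ≤ one) (hs : IsSupAt one 0 s) : ¬ one ≤ 0 := by
  intro hle
  obtain rfl : one = 0 := le_antisymm hle hone
  obtain ⟨q, hq⟩ := exists_rat_lt s
  exact lt_asymm hq ((hs q).2 ⟨q - 1, by linarith, by simp⟩)

/-- An element with nonpositive supremum lies below every positive rational multiple of the
unit. -/
theorem IsSupAt.le_smul {R : Type*} [Lattice R] [AddCommGroup R] [Module ℚ R]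
    [AddLeftMono R] [PosSMulMono ℚ R] {one a : R} {s : ℝ} (hone : 0 ≤ one)
    (hs : IsSupAt one a s) (hs0 : s ≤ 0) {q : ℚ} (hq : 0 < q) : a ≤ q • one := by
  obtain ⟨r, hr, har⟩ := (hs q).1 (hs0.trans_lt (by exact_mod_cast hq))
  have hnonneg : 0 ≤ (q - r) • one := smul_nonneg (by linarith) hone
  rw [sub_smul] at hnonneg
  exact har.trans (sub_nonneg.1 hnonneg)

/-- A bound `one ≤ N • (t + (2 * N)⁻¹ • one)` can be absorbed into `one ≤ (2 * N) • t`. -/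
theorem le_two_mul_nsmul_of_le_nsmul_add {R : Type*} [Lattice R] [AddCommGroup R] [Module ℚ R]
    [AddLeftMono R] {one t : R} {N : ℕ} (hN : N ≠ 0)
    (h : one ≤ N • (t + (2 * N : ℚ)⁻¹ • one)) : one ≤ (2 * N) • t := by
  have hN' : (N : ℚ) ≠ 0 := by exact_mod_cast hN
  have hhalf : (2 * N) • ((2 * N : ℚ)⁻¹ • one) = one := by
    rw [← Nat.cast_smul_eq_nsmul ℚ, smul_smul]
    push_cast
    rw [mul_inv_cancel₀ (by positivity), one_smul]
  have h2 := nsmul_le_nsmul_right h 2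
  rw [smul_smul, nsmul_add, hhalf, two_nsmul] at h2
  exact le_of_add_le_add_right h2

/-- In a Riesz space with strong unit in which every element is normable,
if `1 ≤ N • (a₁⁺ ⊔ … ⊔ a_m⁺)` (with `m ≥ 1`), then there is a nonempty subset `S` of the
indices with `Pos aᵢ` for every `i ∈ S` and `1 ≤ M • ⨆_{i ∈ S} aᵢ⁺` for some `M ∈ ℕ`. -/
theorem stone_yosida_stmt8 {R : Type*} [Lattice R] [AddCommGroup R] [Module ℚ R]
    [CovariantClass R R (· + ·) (· ≤ ·)] [PosSMulMono ℚ R]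
    (one : R) (hone : 0 ≤ one) (hstrong : ∀ a : R, ∃ n : ℕ, a ≤ n • one)
    (hnorm : ∀ a : R, ∃ s : ℝ, IsSupAt one a s)
    (m : ℕ) (hm : 1 ≤ m) (a : Fin m → R)
    (h : ∃ N : ℕ, one ≤ N • (Finset.univ.sup' (Finset.univ_nonempty_iff.mpr ⟨⟨0, hm⟩⟩)
      fun i => a i ⊔ 0)) :
    ∃ S : Finset (Fin m), ∃ hS : S.Nonempty,
      (∀ i ∈ S, Pos one (a i)) ∧
      ∃ M : ℕ, one ≤ M • (S.sup' hS fun i => a i ⊔ 0) := by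
  classical
  obtain ⟨N, hN⟩ := h
  have hpos : ¬ one ≤ 0 := by
    obtain ⟨s, hs⟩ := hnorm 0
    exact hs.not_le_zero hone
  have hN0 : N ≠ 0 := by
    rintro rfl
    exact hpos (by simpa using hN)
  have hq : (0 : ℚ) < (2 * N : ℚ)⁻¹ := by positivity
  have hsmall : ∀ i, ¬ Pos one (a i) → a i ⊔ 0 ≤ (2 * N : ℚ)⁻¹ • one := by
    intro i hi
    obtain ⟨s, hs⟩ := hnorm (a i)
    have hs0 : s ≤ 0 := not_lt.1 fun hlt => hi ⟨s, hs, hlt⟩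
    exact sup_le (hs.le_smul hone hs0 hq) (smul_nonneg hq.le hone)
  have habsorb : ∀ t : R, 0 ≤ t → (∀ i, Pos one (a i) → a i ⊔ 0 ≤ t) →
      one ≤ (2 * N) • t := by
    intro t ht hle
    refine le_two_mul_nsmul_of_le_nsmul_add hN0
      (hN.trans (nsmul_le_nsmul_right (Finset.sup'_le _ _ fun i _ => ?_) N))
    by_cases hi : Pos one (a i)
    · exact (hle i hi).trans (le_add_of_nonneg_right (smul_nonneg hq.le hone))
    · exact (hsmall i hi).trans (le_add_of_nonneg_left ht)
  have hS : (Finset.univ.filter fun i => Pos one (a i)).Nonempty := by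
    by_contra hempty
    refine hpos ((habsorb 0 le_rfl fun i hi => ?_).trans (smul_zero _).le)
    exact absurd ⟨i, by simpa using hi⟩ hempty
  refine ⟨_, hS, fun i hi => (Finset.mem_filter.1 hi).2, 2 * N, habsorb _ ?_ fun i hi => ?_⟩
  · obtain ⟨i, hi⟩ := hS
    exact le_sup_right.trans (Finset.le_sup' (fun i => a i ⊔ 0) hi)
  · exact Finset.le_sup' (fun i => a i ⊔ 0) (by simpa using hi)
end

section
/- Let R be a Riesz space with strong unit 1, let a, b ∈ R, let ε ≥ 0 be rational with |a − b| ≤ ε • 1, and let (p, q) and (u, v) be rational intervals. If Pos(((a − p • 1) ⊓ (q • 1 − a)) ⊓ ((b − u • 1) ⊓ (v • 1 − b))), then u − q ≤ ε and p − v ≤ ε (i.e., the distance between the intervals (p, q) and (u, v) is at most ε). -/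
theorem Pos.nonneg_of_add_self_le {R : Type*} [Lattice R] [AddCommGroup R] [Module ℚ R]
    [PosSMulMono ℚ R] {one x : R} (hx : Pos one x) {r : ℚ} (h : x + x ≤ r • one) : 0 ≤ r := by
  obtain ⟨s, hs, hs0⟩ := hx
  by_contra! hr
  have hhalf : x ≤ (r / 2) • one := by
    have := smul_le_smul_of_nonneg_left h (by norm_num : (0 : ℚ) ≤ 1 / 2)
    rw [← two_smul ℚ x, smul_smul, smul_smul] at this
    norm_num at this
    rwa [show r / 2 = 1 / 2 * r by ring]
  have hlt : s < ((0 : ℚ) : ℝ) := (hs 0).2 ⟨r / 2, by linarith, hhalf⟩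
  rw [Rat.cast_zero] at hlt
  exact lt_asymm hs0 hlt

/-- In a Riesz space with strong unit, if `|a - b| ≤ ε • 1` with `ε ≥ 0`
rational, and `Pos (((a - p•1) ⊓ (q•1 - a)) ⊓ ((b - u•1) ⊓ (v•1 - b)))`, then the
distance between the intervals `(p, q)` and `(u, v)` is at most `ε`:
`u - q ≤ ε` and `p - v ≤ ε`.  Here `|x| := (x ⊔ 0) + ((-x) ⊔ 0)`. -/
theorem stone_yosida_stmt9 {R : Type*} [Lattice R] [AddCommGroup R] [Module ℚ R]
    [CovariantClass R R (· + ·) (· ≤ ·)] [PosSMulMono ℚ R]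
    (one : R) (hone : 0 ≤ one) (hstrong : ∀ a : R, ∃ n : ℕ, a ≤ n • one)
    (a b : R) (ε : ℚ) (hε : 0 ≤ ε)
    (habs : ((a - b) ⊔ 0) + ((-(a - b)) ⊔ 0) ≤ ε • one)
    (p q u v : ℚ)
    (hpos : Pos one (((a - p • one) ⊓ (q • one - a)) ⊓ ((b - u • one) ⊓ (v • one - b)))) :
    u - q ≤ ε ∧ p - v ≤ ε := by
  have : IsOrderedAddMonoid R := { add_le_add_left := fun _ _ h c => add_le_add_left h c }
  set x := ((a - p • one) ⊓ (q • one - a)) ⊓ ((b - u • one) ⊓ (v • one - b))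
  have hab : a - b ≤ ε • one :=
    (le_add_of_le_of_nonneg le_sup_left le_sup_right).trans habs
  have hba : -(a - b) ≤ ε • one :=
    (le_add_of_nonneg_of_le le_sup_right le_sup_left).trans habs
  have hap : x ≤ a - p • one := inf_le_left.trans inf_le_left
  have hqa : x ≤ q • one - a := inf_le_left.trans inf_le_right
  have hbu : x ≤ b - u • one := inf_le_right.trans inf_le_left
  have hvb : x ≤ v • one - b := inf_le_right.trans inf_le_right
  constructor
  · have key : x + x ≤ (ε + q - u) • one := by
      calc x + x ≤ (q • one - a) + (b - u • one) := add_le_add hqa hbu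
        _ = -(a - b) + (q - u) • one := by module
        _ ≤ ε • one + (q - u) • one := by gcongr
        _ = (ε + q - u) • one := by module
    linarith [hpos.nonneg_of_add_self_le key]
  · have key : x + x ≤ (ε + v - p) • one := by
      calc x + x ≤ (a - p • one) + (v • one - b) := add_le_add hap hvb
        _ = (a - b) + (v - p) • one := by module
        _ ≤ ε • one + (v - p) • one := by gcongr
        _ = (ε + v - p) • one := by module
    linarith [hpos.nonneg_of_add_self_le key]
end

section
/- Let R be a separable Riesz space with strong unit 1 in which every element is normable. If Pos(a) for some a ∈ R, then there exists a representation σ of R with σ(a) > 0. -/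
/-- A representation of the Riesz space `R` with unit `one`: a `ℚ`-linear map
`σ : R → ℝ` with `σ 1 = 1` preserving binary suprema. -/
def IsRepresentation {R : Type*} [Lattice R] [AddCommGroup R] [Module ℚ R]
    (one : R) (σ : R → ℝ) : Prop :=
  (∀ x y : R, σ (x + y) = σ x + σ y) ∧
  (∀ (q : ℚ) (x : R), σ (q • x) = q * σ x) ∧
  σ one = 1 ∧
  (∀ x y : R, σ (x ⊔ y) = max (σ x) (σ y))

section NonposCone

variable {R : Type*} [Lattice R] [AddCommGroup R] [Module ℚ R]

/-- The set of elements that are nonpositive modulo some proper ideal of the Riesz space `R`,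
properness being expressed by `one ∉ J`. -/
structure IsProperNonposCone (one : R) (J : Set R) : Prop where
  zero_mem : 0 ∈ J
  add_mem : ∀ {x y}, x ∈ J → y ∈ J → x + y ∈ J
  smul_mem : ∀ {c : ℚ} {x}, 0 ≤ c → x ∈ J → c • x ∈ J
  mem_of_le : ∀ {x y}, x ≤ y → y ∈ J → x ∈ J
  sup_zero_mem : ∀ {x}, x ∈ J → x ⊔ 0 ∈ J
  one_notMem : one ∉ J

/-- `t` is the value of `x` determined by the cut of rationals `r` with `r ≤ x` modulo `J`. -/
def IsCutValue (one : R) (J : Set R) (x : R) (t : ℝ) : Prop :=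
  ∀ r : ℚ, ((r : ℝ) < t → r • one - x ∈ J) ∧ (t < r → x - r • one ∈ J)

section Order

theorem le_inv_smul_of_smul_le [PosSMulMono ℚ R] {c : ℚ} (hc : 0 < c) {x y : R} (h : x ≤ c • y) :
    c⁻¹ • x ≤ y := by
  have := smul_le_smul_of_nonneg_left h (inv_nonneg.2 hc.le)
  rwa [inv_smul_smul₀ hc.ne'] at this

variable [IsOrderedAddMonoid R] [PosSMulMono ℚ R]

theorem rat_smul_le_smul_right {c d : ℚ} {x : R} (hcd : c ≤ d) (hx : 0 ≤ x) : c • x ≤ d • x := by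
  have := smul_nonneg (sub_nonneg.2 hcd) hx
  rwa [sub_smul, sub_nonneg] at this

/-- An element dominated by multiples of both parts of `x` is nonpositive. -/
theorem nonpos_of_le_smul_parts {c d : ℚ} (hc : 0 ≤ c) (hd : 0 ≤ d) {x z : R}
    (h₁ : z ≤ c • (x ⊔ 0)) (h₂ : z ≤ d • (-x ⊔ 0)) : z ≤ 0 := by
  have hN : 0 < c + d + 1 := by linarith
  have h₁' := le_inv_smul_of_smul_le hN (h₁.trans
    (rat_smul_le_smul_right (show c ≤ c + d + 1 by linarith) le_sup_right))
  have h₂' := le_inv_smul_of_smul_le hN (h₂.trans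
    (rat_smul_le_smul_right (show d ≤ c + d + 1 by linarith) le_sup_right))
  have h := (le_inf h₁' h₂').trans_eq (posPart_inf_negPart_eq_zero x)
  simpa [smul_inv_smul₀ hN.ne'] using smul_le_smul_of_nonneg_left h hN.le

theorem le_of_le_smul_sup_zero {one : R} (hunit : ∀ x : R, ∃ c : ℚ, 0 ≤ c ∧ x ≤ c • one)
    {c : ℚ} (hc : 0 ≤ c) {w : R} (h : one ≤ c • (w ⊔ 0)) : ∃ ε : ℚ, 0 < ε ∧ ε • one ≤ w := by
  obtain ⟨M, hM, hwM⟩ := hunit (-w ⊔ 0)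
  have hneg : -w ⊔ 0 ≤ 0 := by
    refine nonpos_of_le_smul_parts (mul_nonneg hM hc) zero_le_one
      (hwM.trans ?_) (one_smul ℚ (-w ⊔ 0)).ge
    rw [mul_smul]
    exact smul_le_smul_of_nonneg_left h hM
  have hw : 0 ≤ w := neg_nonpos.1 (le_sup_left.trans hneg)
  rw [sup_of_le_left hw] at h
  have hc' : 0 < c + 1 := by linarith
  exact ⟨(c + 1)⁻¹, inv_pos.2 hc', le_inv_smul_of_smul_le hc'
    (h.trans (rat_smul_le_smul_right (by linarith) hw))⟩

end Order

namespace IsProperNonposCone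

variable {one : R} {J : Set R}

theorem smul_one_notMem (hJ : IsProperNonposCone one J) {c : ℚ} (hc : 0 < c) : c • one ∉ J :=
  fun h => hJ.one_notMem <| by
    simpa [inv_smul_smul₀ hc.ne'] using hJ.smul_mem (inv_nonneg.2 hc.le) h

theorem isCutValue_unique (hJ : IsProperNonposCone one J) {x : R} {t t' : ℝ}
    (ht : IsCutValue one J x t) (ht' : IsCutValue one J x t') : t = t' := by
  have key : ∀ {t t' : ℝ}, IsCutValue one J x t → IsCutValue one J x t' → t' ≤ t := by
    intro t t' ht ht'
    by_contra! h
    obtain ⟨r', hr, hr'⟩ := exists_rat_btwn h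
    obtain ⟨r, htr, hrr'⟩ := exists_rat_btwn hr
    refine hJ.smul_one_notMem (sub_pos.2 (Rat.cast_lt.1 hrr')) ?_
    have := hJ.add_mem ((ht r).2 htr) ((ht' r').1 hr')
    rwa [show x - r • one + (r' • one - x) = (r' - r) • one by rw [sub_smul]; abel] at this
  exact le_antisymm (key ht' ht) (key ht ht')

theorem isCutValue_add (hJ : IsProperNonposCone one J) {x y : R} {t t' : ℝ}
    (hx : IsCutValue one J x t) (hy : IsCutValue one J y t') :
    IsCutValue one J (x + y) (t + t') := by
  refine fun r => ⟨fun h => ?_, fun h => ?_⟩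
  · obtain ⟨p, hp, hpt⟩ := exists_rat_btwn (sub_lt_iff_lt_add.2 h)
    have := hJ.add_mem ((hx p).1 hpt) ((hy (r - p)).1 (by push_cast; linarith))
    rwa [show p • one - x + ((r - p) • one - y) = r • one - (x + y) by
      rw [sub_smul]; abel] at this
  · obtain ⟨p, hp, hpt⟩ := exists_rat_btwn (lt_sub_iff_add_lt.2 h)
    have := hJ.add_mem ((hx p).2 hp) ((hy (r - p)).2 (by push_cast; linarith))
    rwa [show x - p • one + (y - (r - p) • one) = x + y - r • one by
      rw [sub_smul]; abel] at this

variable [IsOrderedAddMonoid R]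

theorem isCutValue_sup (hJ : IsProperNonposCone one J) {x y : R} {t t' : ℝ}
    (hx : IsCutValue one J x t) (hy : IsCutValue one J y t') :
    IsCutValue one J (x ⊔ y) (max t t') := by
  refine fun r => ⟨fun h => ?_, fun h => ?_⟩
  · rcases lt_max_iff.1 h with h | h
    · exact hJ.mem_of_le (sub_le_sub_left le_sup_left _) ((hx r).1 h)
    · exact hJ.mem_of_le (sub_le_sub_left le_sup_right _) ((hy r).1 h)
  · obtain ⟨h₁, h₂⟩ := max_lt_iff.1 h
    refine hJ.mem_of_le ?_
      (hJ.add_mem (hJ.sup_zero_mem ((hx r).2 h₁)) (hJ.sup_zero_mem ((hy r).2 h₂)))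
    rw [sub_le_iff_le_add]
    refine sup_le ?_ ?_ <;> rw [← sub_le_iff_le_add]
    · exact le_add_of_le_of_nonneg le_sup_left le_sup_right
    · exact le_add_of_nonneg_of_le le_sup_right le_sup_left

theorem exists_isCutValue (hJ : IsProperNonposCone one J)
    (hunit : ∀ x : R, ∃ c : ℚ, 0 ≤ c ∧ x ≤ c • one) (htotal : ∀ x, x ∈ J ∨ -x ∈ J) (x : R) :
    ∃ t, IsCutValue one J x t := by
  let S : Set ℝ := {t | ∃ r : ℚ, (r : ℝ) = t ∧ r • one - x ∈ J}
  have hlt : ∀ {r p : ℚ}, r • one - x ∈ J → x - p • one ∈ J → r ≤ p := by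
    intro r p hr hp
    by_contra! h
    refine hJ.smul_one_notMem (sub_pos.2 h) ?_
    have := hJ.add_mem hr hp
    rwa [show r • one - x + (x - p • one) = (r - p) • one by rw [sub_smul]; abel] at this
  have hbdd : BddAbove S := by
    obtain ⟨c, -, hc⟩ := hunit x
    refine ⟨c, ?_⟩
    rintro _ ⟨r, rfl, hr⟩
    exact_mod_cast hlt hr (hJ.mem_of_le (sub_nonpos.2 hc) hJ.zero_mem)
  have hne : S.Nonempty := by
    obtain ⟨c, -, hc⟩ := hunit (-x)
    refine ⟨_, -c, rfl, hJ.mem_of_le ?_ hJ.zero_mem⟩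
    rw [neg_smul, sub_nonpos]
    exact neg_le.1 hc
  refine ⟨sSup S, fun r => ⟨fun h => ?_, fun h => ?_⟩⟩
  · obtain ⟨_, ⟨p, rfl, hp⟩, hrp⟩ := exists_lt_of_lt_csSup hne h
    by_contra hr
    have hr' : x - r • one ∈ J := by simpa using (htotal (r • one - x)).resolve_left hr
    exact (hlt hp hr').not_gt (by exact_mod_cast hrp)
  · have hr : r • one - x ∉ J := fun hr => h.not_ge (le_csSup hbdd ⟨r, rfl, hr⟩)
    simpa using (htotal (r • one - x)).resolve_left hr

variable [PosSMulMono ℚ R]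

theorem isCutValue_one (hJ : IsProperNonposCone one J) (hone : 0 ≤ one) :
    IsCutValue one J one 1 := by
  refine fun r => ⟨fun h => hJ.mem_of_le ?_ hJ.zero_mem, fun h => hJ.mem_of_le ?_ hJ.zero_mem⟩
  · have := rat_smul_le_smul_right (show r ≤ 1 by exact_mod_cast h.le) hone
    simpa using this
  · have := rat_smul_le_smul_right (show 1 ≤ r by exact_mod_cast h.le) hone
    simpa using this

/-- Maximal proper cones are total, i.e. the corresponding ideals are prime. -/
theorem mem_or_neg_mem (hJ : IsProperNonposCone one J)
    (hmax : ∀ K, IsProperNonposCone one K → J ⊆ K → K ⊆ J) (x : R) : x ∈ J ∨ -x ∈ J := by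
  have key : ∀ x ∉ J, ∃ i ∈ J, ∃ c : ℚ, 0 ≤ c ∧ one ≤ i + c • (x ⊔ 0) := by
    intro x hx
    by_contra hno
    refine hx (hmax {z | ∃ i ∈ J, ∃ c : ℚ, 0 ≤ c ∧ z ≤ i + c • (x ⊔ 0)} ?_
      (fun i hi => ⟨i, hi, 0, le_rfl, by simp⟩)
      ⟨0, hJ.zero_mem, 1, zero_le_one, by simp⟩)
    refine ⟨⟨0, hJ.zero_mem, 0, le_rfl, by simp⟩, ?_, ?_, ?_, ?_, hno⟩
    · rintro y z ⟨i, hi, c, hc, hy⟩ ⟨j, hj, d, hd, hz⟩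
      refine ⟨i + j, hJ.add_mem hi hj, c + d, add_nonneg hc hd, (add_le_add hy hz).trans_eq ?_⟩
      rw [add_smul]
      abel
    · rintro b y hb ⟨i, hi, c, hc, hy⟩
      refine ⟨b • i, hJ.smul_mem hb hi, b * c, mul_nonneg hb hc, ?_⟩
      rw [mul_smul, ← smul_add]
      exact smul_le_smul_of_nonneg_left hy hb
    · rintro y z hyz ⟨i, hi, c, hc, hz⟩
      exact ⟨i, hi, c, hc, hyz.trans hz⟩
    · rintro y ⟨i, hi, c, hc, hy⟩
      have hn : (0 : R) ≤ c • (x ⊔ 0) := smul_nonneg hc le_sup_right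
      exact ⟨i ⊔ 0, hJ.sup_zero_mem hi, c, hc,
        sup_le (hy.trans (add_le_add le_sup_left le_rfl)) (add_nonneg le_sup_right hn)⟩
  by_contra! h
  obtain ⟨i, hi, c, hc, hci⟩ := key x h.1
  obtain ⟨j, hj, d, hd, hdj⟩ := key (-x) h.2
  refine hJ.one_notMem (hJ.mem_of_le ?_ (hJ.add_mem (hJ.sup_zero_mem hi) (hJ.sup_zero_mem hj)))
  refine sub_nonpos.1 (nonpos_of_le_smul_parts (x := x) hc hd ?_ ?_) <;> rw [sub_le_iff_le_add']
  · exact hci.trans (add_le_add (le_add_of_le_of_nonneg le_sup_left le_sup_right) le_rfl)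
  · exact hdj.trans (add_le_add (le_add_of_nonneg_of_le le_sup_right le_sup_left) le_rfl)

end IsProperNonposCone

theorem isProperNonposCone_sUnion {one : R} {C : Set (Set R)}
    (hC : ∀ J ∈ C, IsProperNonposCone one J) (hchain : IsChain (· ⊆ ·) C) (hne : C.Nonempty) :
    IsProperNonposCone one (⋃₀ C) where
  zero_mem := hne.elim fun J hJ => ⟨J, hJ, (hC J hJ).zero_mem⟩
  add_mem := by
    rintro x y ⟨J, hJ, hx⟩ ⟨K, hK, hy⟩
    rcases hchain.total hJ hK with h | h
    · exact ⟨K, hK, (hC K hK).add_mem (h hx) hy⟩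
    · exact ⟨J, hJ, (hC J hJ).add_mem hx (h hy)⟩
  smul_mem := by
    rintro c x hc ⟨J, hJ, hx⟩
    exact ⟨J, hJ, (hC J hJ).smul_mem hc hx⟩
  mem_of_le := by
    rintro x y hxy ⟨J, hJ, hy⟩
    exact ⟨J, hJ, (hC J hJ).mem_of_le hxy hy⟩
  sup_zero_mem := by
    rintro x ⟨J, hJ, hx⟩
    exact ⟨J, hJ, (hC J hJ).sup_zero_mem hx⟩
  one_notMem := by
    rintro ⟨J, hJ, h⟩
    exact (hC J hJ).one_notMem h

theorem exists_maximal_isProperNonposCone [IsOrderedAddMonoid R] [PosSMulMono ℚ R] {one w : R}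
    (hunit : ∀ x : R, ∃ c : ℚ, 0 ≤ c ∧ x ≤ c • one) (hw : ∀ ε : ℚ, 0 < ε → ¬ε • one ≤ w) :
    ∃ J, IsProperNonposCone one J ∧ (∀ K, IsProperNonposCone one K → J ⊆ K → K ⊆ J) ∧ w ∈ J := by
  have hJ₀ : IsProperNonposCone one {z | ∃ c : ℚ, 0 ≤ c ∧ z ≤ c • (w ⊔ 0)} := by
    refine ⟨⟨0, le_rfl, by simp⟩, ?_, ?_, ?_, ?_, ?_⟩
    · rintro y z ⟨c, hc, hy⟩ ⟨d, hd, hz⟩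
      exact ⟨c + d, add_nonneg hc hd, (add_le_add hy hz).trans_eq (add_smul _ _ _).symm⟩
    · rintro b y hb ⟨c, hc, hy⟩
      refine ⟨b * c, mul_nonneg hb hc, ?_⟩
      rw [mul_smul]
      exact smul_le_smul_of_nonneg_left hy hb
    · rintro y z hyz ⟨c, hc, hz⟩
      exact ⟨c, hc, hyz.trans hz⟩
    · rintro y ⟨c, hc, hy⟩
      exact ⟨c, hc, sup_le hy (smul_nonneg hc le_sup_right)⟩
    · rintro ⟨c, hc, h⟩
      obtain ⟨ε, hε, h⟩ := le_of_le_smul_sup_zero hunit hc h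
      exact hw ε hε h
  obtain ⟨J, hJ₀J, hJ⟩ := zorn_subset_nonempty {J | IsProperNonposCone one J}
    (fun C hC hchain hne => ⟨⋃₀ C, isProperNonposCone_sUnion hC hchain hne,
      fun _ => Set.subset_sUnion_of_mem⟩) _ hJ₀
  exact ⟨J, hJ.prop, fun K hK h => hJ.le_of_ge hK h,
    hJ₀J ⟨1, zero_le_one, by simp⟩⟩

end NonposCone

/-- Let `R` be a separable Riesz space with strong unit in which every
element is normable.  If `Pos a`, then there is a representation `σ` with `σ a > 0`. -/
theorem stone_yosida_stmt10 {R : Type*} [Lattice R] [AddCommGroup R] [Module ℚ R]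
    [CovariantClass R R (· + ·) (· ≤ ·)] [PosSMulMono ℚ R]
    (one : R) (hone : 0 ≤ one) (hstrong : ∀ a : R, ∃ n : ℕ, a ≤ n • one)
    (u : ℕ → R)
    (hsep : ∀ a : R, ∀ ε : ℚ, 0 < ε →
      ∃ n : ℕ, ((a - u n) ⊔ 0) + ((-(a - u n)) ⊔ 0) ≤ ε • one)
    (hnorm : ∀ a : R, ∃ s : ℝ, IsSupAt one a s)
    (a : R) (ha : Pos one a) :
    ∃ σ : R → ℝ, IsRepresentation one σ ∧ 0 < σ a := by
  obtain ⟨s, hs, hs0⟩ := ha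
  obtain ⟨q, hq0, hqs⟩ := exists_rat_btwn hs0
  have hadd_le : ∀ x y : R, x ≤ y → ∀ z, x + z ≤ y + z := fun x y h z => by
    rw [add_comm x z, add_comm y z]
    exact add_le_add_right h z
  have : IsOrderedAddMonoid R := { add_le_add_left := hadd_le }
  have hunit : ∀ x : R, ∃ c : ℚ, 0 ≤ c ∧ x ≤ c • one := fun x => by
    obtain ⟨n, hn⟩ := hstrong x
    exact ⟨n, n.cast_nonneg, by rwa [Nat.cast_smul_eq_nsmul]⟩
  obtain ⟨J, hJ, hmax, hmem⟩ := exists_maximal_isProperNonposCone (w := q • one - a) hunit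
    fun ε hε h => by
      have : s < q := (hs q).2 ⟨q - ε, by linarith, by
        rw [sub_smul]
        exact le_sub_comm.1 h⟩
      linarith
  choose σ hσ using hJ.exists_isCutValue hunit (hJ.mem_or_neg_mem hmax)
  have hadd : ∀ x y, σ (x + y) = σ x + σ y := fun x y =>
    hJ.isCutValue_unique (hσ _) (hJ.isCutValue_add (hσ x) (hσ y))
  refine ⟨σ, ⟨hadd, fun r x => ?_, hJ.isCutValue_unique (hσ _) (hJ.isCutValue_one hone),
    fun x y => hJ.isCutValue_unique (hσ _) (hJ.isCutValue_sup (hσ x) (hσ y))⟩, ?_⟩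
  · have := map_rat_smul (AddMonoidHom.mk' σ hadd) r x
    simpa [Rat.smul_def] using this
  · by_contra! h
    obtain ⟨r, hr, hrq⟩ := exists_rat_btwn (h.trans_lt hq0)
    refine hJ.smul_one_notMem (sub_pos.2 (Rat.cast_lt.1 hrq)) ?_
    have := hJ.add_mem ((hσ a r).2 hr) hmem
    rwa [show a - r • one + (q • one - a) = (q - r) • one by rw [sub_smul]; abel] at this
end

section
/- Let R be a separable Riesz space with strong unit 1 in which every element is normable, and let a ∈ R. Write ‖a‖ for the supremum of |a|. Then ‖a‖ is the least upper bound of the set {|σ(a)| : σ a representation of R}; in particular |σ(a)| ≤ ‖a‖ for every representation σ, and for every real r < ‖a‖ there exists a representation σ with r < |σ(a)|. -/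
section RieszSpace

variable {R : Type*} [Lattice R] [AddCommGroup R]

namespace IsRepresentation

variable [Module ℚ R] {one : R} {σ : R → ℝ}

theorem map_abs (hσ : IsRepresentation one σ) (x : R) : σ (x ⊔ 0 + -x ⊔ 0) = |σ x| := by
  obtain ⟨hadd, hsmul, -, hsup⟩ := hσ
  have h0 : σ 0 = 0 := by simpa using hsmul 0 0
  have hneg : σ (-x) = -σ x := by simpa using hsmul (-1) x
  rw [hadd, hsup, hsup, h0, hneg]
  exact posPart_add_negPart (σ x)

theorem le_of_le_smul (hσ : IsRepresentation one σ) {x : R} {q : ℚ} (h : x ≤ q • one) :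
    σ x ≤ q := by
  obtain ⟨-, hsmul, h1, hsup⟩ := hσ
  have := hsup x (q • one)
  rw [sup_eq_right.2 h, hsmul, h1, mul_one] at this
  exact this ▸ le_max_left _ _

theorem le_of_isSupAt (hσ : IsRepresentation one σ) {x : R} {s : ℝ} (hs : IsSupAt one x s) :
    σ x ≤ s := by
  by_contra! h
  obtain ⟨q, h1, h2⟩ := exists_rat_btwn h
  obtain ⟨p, hpq, hp⟩ := (hs q).1 h1
  have := hσ.le_of_le_smul hp
  have : (p : ℝ) < q := Rat.cast_lt.2 hpq
  linarith

end IsRepresentation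

/-- The set of elements lying below some member of a Riesz ideal. -/
structure IsIdealShadow (M : Set R) : Prop where
  lower : ∀ {x y : R}, x ≤ y → y ∈ M → x ∈ M
  zero : (0 : R) ∈ M
  add : ∀ {x y : R}, x ∈ M → y ∈ M → x + y ∈ M
  sup_zero : ∀ {x : R}, x ∈ M → x ⊔ 0 ∈ M

namespace IsIdealShadow

variable {M : Set R}

theorem nsmul (hM : IsIdealShadow M) {x : R} (hx : x ∈ M) (n : ℕ) : n • x ∈ M := by
  induction n with
  | zero => simpa using hM.zero
  | succ n ih => rw [succ_nsmul]; exact hM.add ih hx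

theorem sUnion {c : Set (Set R)} (hc : IsChain (· ⊆ ·) c) (hne : c.Nonempty)
    (h : ∀ M ∈ c, IsIdealShadow M) : IsIdealShadow (⋃₀ c) where
  lower := fun hxy ⟨M, hM, hy⟩ => ⟨M, hM, (h M hM).lower hxy hy⟩
  zero := let ⟨M, hM⟩ := hne; ⟨M, hM, (h M hM).zero⟩
  add := by
    rintro x y ⟨M, hM, hx⟩ ⟨N, hN, hy⟩
    rcases hc.total hM hN with hMN | hNM
    · exact ⟨N, hN, (h N hN).add (hMN hx) hy⟩
    · exact ⟨M, hM, (h M hM).add hx (hNM hy)⟩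
  sup_zero := fun ⟨M, hM, hx⟩ => ⟨M, hM, (h M hM).sup_zero hx⟩

variable [IsOrderedAddMonoid R]

theorem setOf_nonpos : IsIdealShadow {x : R | x ≤ 0} where
  lower := fun hxy hy => le_trans hxy hy
  zero := le_refl (0 : R)
  add := fun hx hy => add_nonpos hx hy
  sup_zero := fun hx => sup_le hx le_rfl

theorem adjoin (hM : IsIdealShadow M) {c : R} (hc : 0 ≤ c) :
    IsIdealShadow {z : R | ∃ m ∈ M, ∃ n : ℕ, z ≤ m + n • c} where
  lower := fun hxy ⟨m, hm, n, hy⟩ => ⟨m, hm, n, hxy.trans hy⟩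
  zero := ⟨0, hM.zero, 0, by simp⟩
  add := by
    rintro x y ⟨m, hm, n, hx⟩ ⟨k, hk, l, hy⟩
    refine ⟨m + k, hM.add hm hk, n + l, (add_le_add hx hy).trans (le_of_eq ?_)⟩
    rw [add_nsmul]; abel
  sup_zero := by
    rintro x ⟨m, hm, n, hx⟩
    refine ⟨m ⊔ 0, hM.sup_zero hm, n, sup_le (hx.trans ?_) ?_⟩
    · gcongr; exact le_sup_left
    · exact add_nonneg le_sup_right (nsmul_nonneg hc n)

end IsIdealShadow

variable [IsOrderedAddMonoid R]

theorem sup_zero_inf_neg_sup_zero_le (x : R) : (x ⊔ 0) ⊓ (-x ⊔ 0) ≤ 0 := by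
  have := posPart_inf_negPart_eq_zero x
  rw [posPart_def, negPart_def] at this
  exact this.le

variable [Module ℚ R] [PosSMulMono ℚ R]

theorem nonpos_of_le_nsmul_of_le_nsmul {x y z : R} (hx : 0 ≤ x) (hy : 0 ≤ y) (hxy : x ⊓ y ≤ 0)
    {m n : ℕ} (hzx : z ≤ m • x) (hzy : z ≤ n • y) : z ≤ 0 := by
  have hpos : (0 : ℚ) < ((m + n + 1 : ℕ) : ℚ) := by positivity
  have hinv : ∀ w : R, z ≤ (m + n + 1) • w → ((m + n + 1 : ℕ) : ℚ)⁻¹ • z ≤ w := by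
    intro w hw
    rw [← Nat.cast_smul_eq_nsmul ℚ] at hw
    have h := smul_le_smul_of_nonneg_left hw (inv_nonneg.2 hpos.le)
    rwa [smul_smul, inv_mul_cancel₀ hpos.ne', one_smul] at h
  have h : ((m + n + 1 : ℕ) : ℚ)⁻¹ • z ≤ 0 :=
    (le_inf (hinv x (hzx.trans (nsmul_le_nsmul_left hx (by omega))))
      (hinv y (hzy.trans (nsmul_le_nsmul_left hy (by omega))))).trans hxy
  have h' := smul_le_smul_of_nonneg_left h hpos.le
  rwa [smul_smul, mul_inv_cancel₀ hpos.ne', one_smul, smul_zero] at h'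

theorem nonneg_of_le_nsmul_sup_zero {one : R} (hstrong : ∀ a : R, ∃ n : ℕ, a ≤ n • one)
    {y : R} {n : ℕ} (h : one ≤ n • (y ⊔ 0)) : 0 ≤ y := by
  obtain ⟨k, hk⟩ := hstrong (-y ⊔ 0)
  have hy : -y ⊔ 0 ≤ (n * k) • (y ⊔ 0) := by
    rw [mul_nsmul]
    exact hk.trans (nsmul_le_nsmul_right h k)
  have := nonpos_of_le_nsmul_of_le_nsmul le_sup_right le_sup_right
    (sup_zero_inf_neg_sup_zero_le y) hy (n := 1) (by simp)
  exact neg_nonpos.1 (le_sup_left.trans this)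

/-- An ideal shadow extends to a maximal one avoiding `one`, which is then the set of nonpositive
elements of a total preorder. -/
theorem IsIdealShadow.exists_total {one : R} {M : Set R} (hM : IsIdealShadow M) (hone : one ∉ M) :
    ∃ N, M ⊆ N ∧ IsIdealShadow N ∧ one ∉ N ∧ ∀ x, x ∈ N ∨ -x ∈ N := by
  obtain ⟨N, hMN, hN⟩ := zorn_subset_nonempty {N : Set R | IsIdealShadow N ∧ one ∉ N}
    (fun c hcS hc hne => ⟨⋃₀ c, ⟨.sUnion hc hne fun M hM => (hcS hM).1,
      fun ⟨M, hM, h⟩ => (hcS hM).2 h⟩, fun s => Set.subset_sUnion_of_mem⟩) M ⟨hM, hone⟩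
  obtain ⟨hNI, hNone⟩ := hN.prop
  refine ⟨N, hMN, hNI, hNone, fun x => ?_⟩
  have key : ∀ y : R, y ∉ N → ∃ m ∈ N, ∃ n : ℕ, one ≤ m + n • (y ⊔ 0) := by
    intro y hy
    by_contra h
    refine hy (hN.le_of_ge (y := {z : R | ∃ m ∈ N, ∃ n : ℕ, z ≤ m + n • (y ⊔ 0)})
      ⟨hNI.adjoin le_sup_right, h⟩ (fun m hm => ⟨m, hm, 0, by simp⟩) ⟨0, hNI.zero, 1, ?_⟩)
    simp
  by_contra! h
  obtain ⟨m, hm, n, h1⟩ := key x h.1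
  obtain ⟨k, hk, l, h2⟩ := key (-x) h.2
  have hle : one - (m ⊔ 0 + k ⊔ 0) ≤ 0 := by
    refine nonpos_of_le_nsmul_of_le_nsmul le_sup_right le_sup_right
      (sup_zero_inf_neg_sup_zero_le x) (m := n) (n := l) ?_ ?_
    · rw [sub_le_iff_le_add']
      refine h1.trans ?_
      gcongr
      exact le_sup_left.trans (le_add_of_nonneg_right le_sup_right)
    · rw [sub_le_iff_le_add']
      refine h2.trans ?_
      gcongr
      exact le_sup_left.trans (le_add_of_nonneg_left le_sup_right)
  exact hNone (hNI.lower (sub_nonpos.1 hle) (hNI.add (hNI.sup_zero hm) (hNI.sup_zero hk)))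

/-- The position of `x` relative to the multiples of `one`, for the preorder whose nonpositive
elements form `M`. -/
noncomputable def cutValue (one : R) (M : Set R) (x : R) : ℝ :=
  sInf ((fun q : ℚ => (q : ℝ)) '' {q : ℚ | x - q • one ∈ M})

namespace IsIdealShadow

variable {M : Set R} {one : R}

theorem le_of_smul_sub_mem (hM : IsIdealShadow M) (hone : 0 ≤ one) (hn : one ∉ M) {x : R} {q t : ℚ}
    (hq : q • one - x ∈ M) (ht : x - t • one ∈ M) : q ≤ t := by
  by_contra! h
  have hmem : (q - t) • one ∈ M := by
    have := hM.add hq ht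
    rwa [sub_add_sub_cancel, ← sub_smul] at this
  obtain ⟨n, hn'⟩ := exists_nat_gt (q - t)⁻¹
  have hpos : 0 < q - t := sub_pos.2 h
  have h1 : 1 ≤ (n : ℚ) * (q - t) := by
    rw [inv_lt_iff_one_lt_mul₀ hpos] at hn'
    linarith
  refine hn (hM.lower ?_ (hM.nsmul hmem n))
  rw [← Nat.cast_smul_eq_nsmul ℚ, smul_smul]
  have h2 := smul_nonneg (sub_nonneg.2 h1) hone
  rwa [sub_smul, one_smul, sub_nonneg] at h2

theorem le_cutValue (hM : IsIdealShadow M) (hone : 0 ≤ one) (hn : one ∉ M)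
    (hstrong : ∀ a : R, ∃ n : ℕ, a ≤ n • one) {x : R} {q : ℚ}
    (hq : q • one - x ∈ M) : (q : ℝ) ≤ cutValue one M x := by
  refine le_csInf ?_ ?_
  · obtain ⟨n, h⟩ := hstrong x
    refine ⟨_, (n : ℚ), hM.lower ?_ hM.zero, rfl⟩
    rwa [Nat.cast_smul_eq_nsmul, sub_nonpos]
  · rintro _ ⟨t, ht, rfl⟩
    exact Rat.cast_le.2 (hM.le_of_smul_sub_mem hone hn hq ht)

theorem cutValue_le (hM : IsIdealShadow M) (hone : 0 ≤ one) (hn : one ∉ M)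
    (hstrong : ∀ a : R, ∃ n : ℕ, a ≤ n • one) {x : R} {q : ℚ}
    (hq : x - q • one ∈ M) : cutValue one M x ≤ q := by
  refine csInf_le ?_ ⟨q, hq, rfl⟩
  obtain ⟨n, h⟩ := hstrong (-x)
  refine ⟨((-n : ℚ) : ℝ), ?_⟩
  rintro _ ⟨t, ht, rfl⟩
  refine Rat.cast_le.2 (hM.le_of_smul_sub_mem hone hn (hM.lower ?_ hM.zero) ht)
  rw [neg_smul, Nat.cast_smul_eq_nsmul, sub_nonpos]
  exact neg_le.1 h

theorem isRepresentation_cutValue (hM : IsIdealShadow M) (hone : 0 ≤ one) (hn : one ∉ M)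
    (hstrong : ∀ a : R, ∃ n : ℕ, a ≤ n • one) (htot : ∀ x, x ∈ M ∨ -x ∈ M) :
    IsRepresentation one (cutValue one M) := by
  have hge {x : R} {q : ℚ} : q • one - x ∈ M → (q : ℝ) ≤ cutValue one M x :=
    hM.le_cutValue hone hn hstrong
  have hle {x : R} {q : ℚ} : x - q • one ∈ M → cutValue one M x ≤ q :=
    hM.cutValue_le hone hn hstrong
  have hlt {x : R} {q : ℚ} (h : cutValue one M x < q) : x - q • one ∈ M := by
    refine (htot _).resolve_right fun h' => h.not_ge (hge ?_)
    rwa [neg_sub] at h'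
  have hgt {x : R} {q : ℚ} (h : q < cutValue one M x) : q • one - x ∈ M := by
    refine (htot _).resolve_right fun h' => h.not_ge (hle ?_)
    rwa [neg_sub] at h'
  have hmono {x y : R} (h : x - y ∈ M) : cutValue one M x ≤ cutValue one M y := by
    by_contra! hxy
    obtain ⟨q, h1, h2⟩ := exists_rat_btwn hxy
    refine h2.not_ge (hle ?_)
    simpa using hM.add h (hlt h1)
  have hadd (x y : R) : cutValue one M (x + y) = cutValue one M x + cutValue one M y := by
    refine le_antisymm ?_ ?_
    · by_contra! h
      obtain ⟨p, h1, h2⟩ := exists_rat_btwn (lt_sub_iff_add_lt.2 h)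
      obtain ⟨q, h3, h4⟩ := exists_rat_btwn (lt_sub_comm.1 h2)
      have := hle (x := x + y) (q := p + q) (by
        have := hM.add (hlt h1) (hlt h3)
        rwa [sub_add_sub_comm, ← add_smul] at this)
      push_cast at this
      linarith
    · by_contra! h
      obtain ⟨p, h1, h2⟩ := exists_rat_btwn (sub_lt_iff_lt_add.2 h)
      obtain ⟨q, h3, h4⟩ := exists_rat_btwn (sub_lt_comm.1 h1)
      have := hge (x := x + y) (q := p + q) (by
        have := hM.add (hgt h2) (hgt h4)
        rwa [sub_add_sub_comm, ← add_smul] at this)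
      push_cast at this
      linarith
  have hsup {x y : R} (h : x - y ∈ M) : cutValue one M (x ⊔ y) = cutValue one M y := by
    refine le_antisymm (hmono ?_) (hmono (hM.lower ?_ hM.zero))
    · have := hM.sup_zero h
      rwa [← sub_self y, ← sup_sub] at this
    · exact sub_nonpos.2 le_sup_right
  refine ⟨hadd, fun q x => ?_, le_antisymm ?_ ?_, fun x y => ?_⟩
  · have := map_rat_smul (AddMonoidHom.mk' (cutValue one M) hadd) q x
    simpa [Rat.smul_def] using this
  · simpa using hle (x := one) (q := 1) (by simpa using hM.zero)
  · simpa using hge (x := one) (q := 1) (by simpa using hM.zero)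
  · rcases htot (x - y) with h | h
    · rw [hsup h, max_eq_right (hmono h)]
    · rw [neg_sub] at h
      rw [sup_comm, hsup h, max_eq_left (hmono h)]

end IsIdealShadow

theorem exists_isRepresentation_lt_abs {one : R} (hone : 0 ≤ one)
    (hstrong : ∀ a : R, ∃ n : ℕ, a ≤ n • one) {a : R} {s r : ℝ}
    (hs : IsSupAt one (a ⊔ 0 + -a ⊔ 0) s) (hr : r < s) :
    ∃ σ : R → ℝ, IsRepresentation one σ ∧ r < |σ a| := by
  obtain ⟨q, hrq, hqs⟩ := exists_rat_btwn hr
  set b : R := q • one - (a ⊔ 0 + -a ⊔ 0) with hb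
  have hI := IsIdealShadow.setOf_nonpos.adjoin (le_sup_right : 0 ≤ b ⊔ 0)
  obtain ⟨N, hsub, hN, hNone, htot⟩ := hI.exists_total (one := one) (by
    rintro ⟨m, hm, n, h⟩
    have h0 : 0 ≤ b := nonneg_of_le_nsmul_sup_zero hstrong
      (h.trans (add_le_of_nonpos_left hm))
    obtain ⟨p, hqp, hps⟩ := exists_rat_btwn hqs
    exact hps.not_gt ((hs p).2 ⟨q, Rat.cast_lt.1 hqp, sub_nonneg.1 h0⟩))
  have hσ := hN.isRepresentation_cutValue hone hNone hstrong htot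
  refine ⟨_, hσ, hrq.trans_le ?_⟩
  rw [← hσ.map_abs]
  exact hN.le_cutValue hone hNone hstrong (hsub ⟨0, le_refl (0 : R), 1, by simp [← hb]⟩)

end RieszSpace

/-- Let `R` be a separable Riesz space with strong unit in which every
element is normable, `a ∈ R`, and let `‖a‖` be the supremum of `|a|`.  Then `‖a‖` is the
least upper bound of `{|σ a| : σ a representation}`; in particular `|σ a| ≤ ‖a‖` for every
representation `σ`, and for every real `r < ‖a‖` there is a representation `σ` with
`r < |σ a|`. -/
theorem stone_yosida_stmt11 {R : Type*} [Lattice R] [AddCommGroup R] [Module ℚ R]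
    [CovariantClass R R (· + ·) (· ≤ ·)] [PosSMulMono ℚ R]
    (one : R) (hone : 0 ≤ one) (hstrong : ∀ a : R, ∃ n : ℕ, a ≤ n • one)
    (u : ℕ → R)
    (hsep : ∀ a : R, ∀ ε : ℚ, 0 < ε →
      ∃ n : ℕ, ((a - u n) ⊔ 0) + ((-(a - u n)) ⊔ 0) ≤ ε • one)
    (hnorm : ∀ a : R, ∃ s : ℝ, IsSupAt one a s)
    (a : R) (na : ℝ) (hna : IsSupAt one ((a ⊔ 0) + ((-a) ⊔ 0)) na) :
    IsLUB {x : ℝ | ∃ σ : R → ℝ, IsRepresentation one σ ∧ x = |σ a|} na ∧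
    (∀ σ : R → ℝ, IsRepresentation one σ → |σ a| ≤ na) ∧
    (∀ r : ℝ, r < na → ∃ σ : R → ℝ, IsRepresentation one σ ∧ r < |σ a|) := by
  have : IsOrderedAddMonoid R :=
    { add_le_add_left := fun x y h z => by
        rw [add_comm x, add_comm y]
        exact CovariantClass.elim z h }
  have hle : ∀ σ : R → ℝ, IsRepresentation one σ → |σ a| ≤ na := fun σ hσ =>
    hσ.map_abs a ▸ hσ.le_of_isSupAt hna
  have hex : ∀ r : ℝ, r < na → ∃ σ : R → ℝ, IsRepresentation one σ ∧ r < |σ a| :=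
    fun r hr => exists_isRepresentation_lt_abs hone hstrong hna hr
  refine ⟨⟨?_, fun x hx => ?_⟩, hle, hex⟩
  · rintro _ ⟨σ, hσ, rfl⟩
    exact hle σ hσ
  · by_contra! h
    obtain ⟨σ, hσ, hlt⟩ := hex x h
    exact hlt.not_ge (hx ⟨σ, hσ, rfl⟩)
end

section
/- Let R be a separable Riesz space with strong unit 1 in which every element is normable. Then the set of representations of R is totally bounded in the weak topology: for any finitely many elements a₁, …, a_k ∈ R and any rational ε > 0 there exist finitely many representations σ₁, …, σ_m of R such that for every representation τ of R there is some j with |τ(aᵢ) − σⱼ(aᵢ)| ≤ ε for all i = 1, …, k. -/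
namespace IsRepresentation

variable {R : Type*} [Lattice R] [AddCommGroup R] [Module ℚ R] {one : R} {σ : R → ℝ}

theorem monotone (h : IsRepresentation one σ) : Monotone σ := fun x y hxy => by
  have := h.2.2.2 x y
  rw [sup_eq_right.2 hxy] at this
  exact this ▸ le_max_left _ _

theorem map_neg (h : IsRepresentation one σ) (x : R) : σ (-x) = -σ x := by
  simpa using h.2.1 (-1) x

theorem map_nsmul_one (h : IsRepresentation one σ) (n : ℕ) : σ (n • one) = n := by
  rw [← Nat.cast_smul_eq_nsmul ℚ, h.2.1, h.2.2.1]
  simp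

end IsRepresentation

/-- The values of all representations at a fixed finite family form a bounded set. -/
theorem isBounded_image_isRepresentation {R ι : Type*} [Fintype ι] [Lattice R] [AddCommGroup R]
    [Module ℚ R] {one : R} (hstrong : ∀ a : R, ∃ n : ℕ, a ≤ n • one) (a : ι → R) :
    Bornology.IsBounded ((fun τ : R → ℝ => τ ∘ a) '' {τ | IsRepresentation one τ}) := by
  choose N hN using hstrong
  refine (Metric.isBounded_Icc (fun i => -(N (-a i) : ℝ)) fun i => (N (a i) : ℝ)).subset ?_
  rintro _ ⟨τ, hτ : IsRepresentation one τ, rfl⟩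
  refine ⟨fun i => ?_, fun i => ?_⟩
  · have := hτ.monotone (hN (-a i))
    rw [hτ.map_neg, hτ.map_nsmul_one] at this
    exact neg_le.1 this
  · have := hτ.monotone (hN (a i))
    rwa [hτ.map_nsmul_one] at this

/-- Let `R` be a separable Riesz space with strong unit in which every
element is normable.  The set of representations of `R` is totally bounded in the weak
topology: for finitely many `a₁, …, a_k ∈ R` and rational `ε > 0` there are finitely many
representations `σ₁, …, σ_m` such that every representation `τ` satisfies
`|τ aᵢ - σⱼ aᵢ| ≤ ε` for all `i`, for some `j`. -/
theorem stone_yosida_stmt12 {R : Type*} [Lattice R] [AddCommGroup R] [Module ℚ R]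
    [CovariantClass R R (· + ·) (· ≤ ·)] [PosSMulMono ℚ R]
    (one : R) (hone : 0 ≤ one) (hstrong : ∀ a : R, ∃ n : ℕ, a ≤ n • one)
    (u : ℕ → R)
    (hsep : ∀ a : R, ∀ ε : ℚ, 0 < ε →
      ∃ n : ℕ, ((a - u n) ⊔ 0) + ((-(a - u n)) ⊔ 0) ≤ ε • one)
    (hnorm : ∀ a : R, ∃ s : ℝ, IsSupAt one a s)
    (k : ℕ) (a : Fin k → R) (ε : ℚ) (hε : 0 < ε) :
    ∃ (m : ℕ) (σ : Fin m → R → ℝ),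
      (∀ j, IsRepresentation one (σ j)) ∧
      ∀ τ : R → ℝ, IsRepresentation one τ →
        ∃ j, ∀ i, |τ (a i) - σ j (a i)| ≤ (ε : ℝ) := by
  obtain ⟨t, ht, htfin, hcov⟩ := Metric.finite_approx_of_totallyBounded
    ((isBounded_image_isRepresentation hstrong a).isCompact_closure.totallyBounded.subset
      subset_closure)
    (ε : ℝ) (by exact_mod_cast hε)
  choose! f hf hfa using fun y (hy : y ∈ t) => ht hy
  have := htfin.to_subtype
  obtain ⟨m, ⟨e⟩⟩ := Finite.exists_equiv_fin t
  refine ⟨m, fun j => f (e.symm j), fun j => hf _ (e.symm j).2, fun τ hτ => ?_⟩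
  obtain ⟨y, hy, hdist⟩ := Set.mem_iUnion₂.1 (hcov ⟨τ, hτ, rfl⟩)
  refine ⟨e ⟨y, hy⟩, fun i => ?_⟩
  have hyi : f y (a i) = y i := congrFun (hfa y hy) i
  simp only [Equiv.symm_apply_apply, hyi]
  rw [← Real.dist_eq]
  exact (dist_le_pi_dist (τ ∘ a) y i).trans (Metric.mem_ball.1 hdist).le
end

section
/- Let H be a complex Hilbert space and A : H →L[ℂ] H a self-adjoint bounded operator with 0 ≤ re⟪A x, x⟫ ≤ ‖x‖² for all x ∈ H. Define A₀ := A and A_{n+1} := A_n − A_n ∘ A_n. Then for every n: A_n is self-adjoint with 0 ≤ re⟪A_n x, x⟫ ≤ ‖x‖² for all x; re⟪A_{n+1} x, x⟫ ≤ re⟪A_n x, x⟫ for all x; A = A₀² + A₁² + ⋯ + A_n² + A_{n+1} (where A_k² := A_k ∘ A_k); and ‖A_n‖ → 0 as n → ∞. In particular, A is the operator-norm limit of finite sums of squares of self-adjoint operators. -/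
open scoped InnerProductSpace

section QuadraticForm

variable {H : Type*} [NormedAddCommGroup H] [InnerProductSpace ℂ H]

/-- A symmetric operator `0 ≤ B ≤ 1` satisfies `B² ≤ B`. -/
lemma norm_apply_sq_le_re_inner (B : H →L[ℂ] H)
    (hB : ∀ x y : H, ⟪B x, y⟫_ℂ = ⟪x, B y⟫_ℂ)
    (hpos : ∀ x : H, 0 ≤ (⟪B x, x⟫_ℂ).re)
    (hle : ∀ x : H, (⟪B x, x⟫_ℂ).re ≤ ‖x‖ ^ 2) (x : H) :
    ‖B x‖ ^ 2 ≤ (⟪B x, x⟫_ℂ).re := by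
  have h1 := hle (B x)
  have h2 := hpos (x - B x)
  have h3 : (⟪B x, B x⟫_ℂ).re = ‖B x‖ ^ 2 := inner_self_eq_norm_sq (𝕜 := ℂ) (B x)
  simp only [map_sub, inner_sub_left, inner_sub_right, Complex.sub_re, hB (B x) x] at h2
  linarith

lemma re_inner_sub_comp_self (B : H →L[ℂ] H)
    (hB : ∀ x y : H, ⟪B x, y⟫_ℂ = ⟪x, B y⟫_ℂ) (x : H) :
    (⟪(B - B.comp B) x, x⟫_ℂ).re = (⟪B x, x⟫_ℂ).re - ‖B x‖ ^ 2 := by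
  have h : (⟪B x, B x⟫_ℂ).re = ‖B x‖ ^ 2 := inner_self_eq_norm_sq (𝕜 := ℂ) (B x)
  rw [sub_apply, inner_sub_left, ContinuousLinearMap.comp_apply, hB (B x) x, Complex.sub_re, h]

/-- If `re⟪B x, x⟫ ≤ c ‖x‖²` with `0 ≤ c ≤ 1`, then `re⟪B x, x⟫ - ‖B x‖² ≤ c / (1 + c) ‖x‖²`. -/
lemma re_inner_sub_norm_apply_sq_le (B : H →L[ℂ] H) {c : ℝ} (hc0 : 0 ≤ c) (hc1 : c ≤ 1) (x : H)
    (hle : (⟪B x, x⟫_ℂ).re ≤ c * ‖x‖ ^ 2) :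
    (⟪B x, x⟫_ℂ).re - ‖B x‖ ^ 2 ≤ c / (1 + c) * ‖x‖ ^ 2 := by
  set s : ℝ := c / (1 + c)
  have hsc : s * (1 + c) = c := div_mul_cancel₀ c (by positivity)
  have hs0 : 0 ≤ s := by positivity
  have hs2 : 0 ≤ 1 - 2 * s := by nlinarith
  have hsq : ‖B x - (s : ℂ) • x‖ ^ 2
      = ‖B x‖ ^ 2 - 2 * (s * (⟪B x, x⟫_ℂ).re) + s ^ 2 * ‖x‖ ^ 2 := by
    rw [@norm_sub_sq ℂ, inner_smul_right, norm_smul, mul_pow]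
    simp
  have hcoef : s ^ 2 + (1 - 2 * s) * c ≤ s := by
    have : s - (s ^ 2 + (1 - 2 * s) * c) = s ^ 2 * c := by
      linear_combination (1 - s) * hsc
    nlinarith [mul_nonneg (sq_nonneg s) hc0]
  nlinarith [sq_nonneg ‖B x - (s : ℂ) • x‖, mul_le_mul_of_nonneg_left hle hs2,
    mul_le_mul_of_nonneg_right hcoef (sq_nonneg ‖x‖)]

end QuadraticForm

/-- Let `A` be self-adjoint with `0 ≤ re⟪A x, x⟫ ≤ ‖x‖²` for all `x`, and
define `A₀ := A`, `A_{n+1} := A_n - A_n²`.  Then each `A_n` is self-adjoint with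
`0 ≤ re⟪A_n x, x⟫ ≤ ‖x‖²`, the quadratic forms decrease, `A = A₀² + ⋯ + A_n² + A_{n+1}`,
`‖A_n‖ → 0`, and the partial sums of squares converge to `A` in operator norm. -/
theorem stone_yosida_stmt14 {H : Type*} [NormedAddCommGroup H] [InnerProductSpace ℂ H]
    [CompleteSpace H] (A : H →L[ℂ] H)
    (hA : ∀ x y : H, ⟪A x, y⟫_ℂ = ⟪x, A y⟫_ℂ)
    (hpos : ∀ x : H, 0 ≤ (⟪A x, x⟫_ℂ).re)
    (hle : ∀ x : H, (⟪A x, x⟫_ℂ).re ≤ ‖x‖ ^ 2)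
    (As : ℕ → H →L[ℂ] H) (hAs0 : As 0 = A)
    (hAsrec : ∀ n : ℕ, As (n + 1) = As n - (As n).comp (As n)) :
    (∀ n : ℕ, (∀ x y : H, ⟪As n x, y⟫_ℂ = ⟪x, As n y⟫_ℂ) ∧
      (∀ x : H, 0 ≤ (⟪As n x, x⟫_ℂ).re ∧ (⟪As n x, x⟫_ℂ).re ≤ ‖x‖ ^ 2)) ∧
    (∀ (n : ℕ) (x : H), (⟪As (n + 1) x, x⟫_ℂ).re ≤ (⟪As n x, x⟫_ℂ).re) ∧
    (∀ n : ℕ, A = (∑ k ∈ Finset.range (n + 1), (As k).comp (As k)) + As (n + 1)) ∧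
    Filter.Tendsto (fun n : ℕ => ‖As n‖) Filter.atTop (nhds 0) ∧
    Filter.Tendsto (fun n : ℕ => ∑ k ∈ Finset.range n, (As k).comp (As k))
      Filter.atTop (nhds A) := by
  have key : ∀ n : ℕ, (∀ x y : H, ⟪As n x, y⟫_ℂ = ⟪x, As n y⟫_ℂ) ∧
      (∀ x : H, 0 ≤ (⟪As n x, x⟫_ℂ).re) ∧
      (∀ x : H, (⟪As n x, x⟫_ℂ).re ≤ 1 / ((n : ℝ) + 1) * ‖x‖ ^ 2) := by
    intro n
    induction n with
    | zero => simpa [hAs0] using ⟨hA, hpos, hle⟩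
    | succ n ih =>
      obtain ⟨hsymm, hnonneg, hbound⟩ := ih
      have hc0 : 0 ≤ 1 / ((n : ℝ) + 1) := by positivity
      have hc1 : 1 / ((n : ℝ) + 1) ≤ 1 := by
        rw [div_le_one (by positivity)]
        linarith [n.cast_nonneg (α := ℝ)]
      have hone : ∀ x : H, (⟪As n x, x⟫_ℂ).re ≤ ‖x‖ ^ 2 := fun x =>
        (hbound x).trans (mul_le_of_le_one_left (sq_nonneg _) hc1)
      rw [hAsrec]
      refine ⟨fun x y => ?_, fun x => ?_, fun x => ?_⟩
      · simp only [sub_apply, ContinuousLinearMap.comp_apply, inner_sub_left, inner_sub_right,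
          hsymm]
      · rw [re_inner_sub_comp_self _ hsymm]
        linarith [norm_apply_sq_le_re_inner _ hsymm hnonneg hone x]
      · rw [re_inner_sub_comp_self _ hsymm]
        convert re_inner_sub_norm_apply_sq_le _ hc0 hc1 x (hbound x) using 2
        push_cast
        field_simp
  have hone : ∀ (n : ℕ) (x : H), (⟪As n x, x⟫_ℂ).re ≤ ‖x‖ ^ 2 := fun n x =>
    ((key n).2.2 x).trans (mul_le_of_le_one_left (sq_nonneg _) (by
      rw [div_le_one (by positivity)]
      linarith [n.cast_nonneg (α := ℝ)]))
  have hsum : ∀ n : ℕ, (∑ k ∈ Finset.range n, (As k).comp (As k)) = A - As n := by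
    intro n
    induction n with
    | zero => simp [hAs0]
    | succ n ih =>
      rw [Finset.sum_range_succ, ih, hAsrec]
      abel
  have hnorm : ∀ n : ℕ, ‖As n‖ ≤ √(1 / ((n : ℝ) + 1)) := by
    intro n
    refine ContinuousLinearMap.opNorm_le_bound _ (Real.sqrt_nonneg _) fun x => ?_
    refine (sq_le_sq₀ (norm_nonneg _) (by positivity)).mp ?_
    rw [mul_pow, Real.sq_sqrt (by positivity)]
    exact (norm_apply_sq_le_re_inner _ (key n).1 (key n).2.1 (hone n) x).trans ((key n).2.2 x)
  have hlim : Filter.Tendsto (fun n : ℕ => ‖As n‖) Filter.atTop (nhds 0) := by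
    refine squeeze_zero (fun n => norm_nonneg _) hnorm ?_
    simpa using (tendsto_one_div_add_atTop_nhds_zero_nat (𝕜 := ℝ)).sqrt
  refine ⟨fun n => ⟨(key n).1, fun x => ⟨(key n).2.1 x, hone n x⟩⟩, fun n x => ?_, fun n => ?_,
    hlim, ?_⟩
  · rw [hAsrec, re_inner_sub_comp_self _ (key n).1]
    linarith [sq_nonneg ‖As n x‖]
  · rw [hsum, sub_add_cancel]
  · simp only [hsum]
    simpa using (tendsto_zero_iff_norm_tendsto_zero.mpr hlim).const_sub A
end

section
/- Let H be a complex Hilbert space and let A, B : H →L[ℂ] H be self-adjoint bounded operators with A ∘ B = B ∘ A. If 0 ≤ re⟪A x, x⟫ for all x ∈ H and 0 ≤ re⟪B x, x⟫ for all x ∈ H, then 0 ≤ re⟪(A ∘ B) x, x⟫ for all x ∈ H. -/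
open scoped InnerProductSpace

/-- If `A`, `B` are commuting self-adjoint bounded operators on a complex
Hilbert space whose quadratic forms are nonnegative, then the quadratic form of `A ∘ B`
is nonnegative. -/
theorem stone_yosida_stmt15 {H : Type*} [NormedAddCommGroup H] [InnerProductSpace ℂ H]
    [CompleteSpace H] (A B : H →L[ℂ] H)
    (hA : ∀ x y : H, ⟪A x, y⟫_ℂ = ⟪x, A y⟫_ℂ)
    (hB : ∀ x y : H, ⟪B x, y⟫_ℂ = ⟪x, B y⟫_ℂ)
    (hcomm : A.comp B = B.comp A)
    (hApos : ∀ x : H, 0 ≤ (⟪A x, x⟫_ℂ).re)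
    (hBpos : ∀ x : H, 0 ≤ (⟪B x, x⟫_ℂ).re) :
    ∀ x : H, 0 ≤ (⟪(A.comp B) x, x⟫_ℂ).re := by
  have hA0 : 0 ≤ A := A.nonneg_iff_isPositive.mpr ⟨hA, hApos⟩
  have hB0 : 0 ≤ B := B.nonneg_iff_isPositive.mpr ⟨hB, hBpos⟩
  have hAB : 0 ≤ A * B := Commute.mul_nonneg hA0 hB0 hcomm
  exact ((A * B).nonneg_iff_isPositive.mp hAB).2
end

section
/- Let R be an f-algebra and let σ : R → ℝ be a representation, i.e., a ℚ-linear map with σ(1) = 1 and σ(a ⊔ b) = max(σ(a), σ(b)) for all a, b ∈ R. Then σ preserves multiplication: σ(a * b) = σ(a) · σ(b) for all a, b ∈ R. -/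
/-- Let `R` be an f-algebra (a Riesz space over `ℚ` with a commutative
ring multiplication whose unit `1` is a strong unit, and with `0 ≤ a * b` whenever
`0 ≤ a`, `0 ≤ b`).  Every representation `σ : R → ℝ` (a `ℚ`-linear map with `σ 1 = 1`
preserving binary suprema) preserves multiplication. -/
theorem stone_yosida_stmt17 {R : Type*} [CommRing R] [Lattice R] [Algebra ℚ R]
    [CovariantClass R R (· + ·) (· ≤ ·)] [PosSMulMono ℚ R]
    (hone : (0 : R) ≤ 1) (hstrong : ∀ a : R, ∃ n : ℕ, a ≤ n • (1 : R))
    (hmulpos : ∀ a b : R, 0 ≤ a → 0 ≤ b → 0 ≤ a * b)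
    (σ : R → ℝ)
    (hadd : ∀ x y : R, σ (x + y) = σ x + σ y)
    (hsmul : ∀ (q : ℚ) (x : R), σ (q • x) = q * σ x)
    (hσone : σ 1 = 1)
    (hsup : ∀ x y : R, σ (x ⊔ y) = max (σ x) (σ y)) :
    ∀ a b : R, σ (a * b) = σ a * σ b := by
  have : IsOrderedAddMonoid R :=
    { add_le_add_left := fun x y h c => by
        simpa only [add_comm] using (CovariantClass.elim c h : c + x ≤ c + y) }
  have hzero : σ 0 = 0 := by simpa using hadd 0 0
  have hneg : ∀ x, σ (-x) = -σ x := fun x => by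
    have h := hadd x (-x)
    rw [add_neg_cancel, hzero] at h
    linarith
  have hnonneg : ∀ x, 0 ≤ x → 0 ≤ σ x := fun x hx => by
    have h := hsup 0 x
    rw [sup_eq_right.2 hx, hzero] at h
    rw [h]
    exact le_max_left _ _
  have hnat : ∀ (n : ℕ) (x : R), σ (n * x) = n * σ x := fun n x => by
    have h := hsmul n x
    rwa [Nat.cast_smul_eq_nsmul, nsmul_eq_mul, Rat.cast_natCast] at h
  intro a b
  obtain ⟨n, hn, hn'⟩ : ∃ n : ℕ, 0 ≤ (n : R) - b ∧ 0 ≤ (n : R) + b := by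
    obtain ⟨k, hk⟩ := hstrong (b ⊔ -b)
    rw [nsmul_one] at hk
    refine ⟨k, sub_nonneg.2 (le_sup_left.trans hk), ?_⟩
    rw [← sub_neg_eq_add]
    exact sub_nonneg.2 (le_sup_right.trans hk)
  have hbound : ∀ x, |σ (x * b)| ≤ n * |σ x| := fun x => by
    have hc : σ (x ⊔ -x) = |σ x| := by rw [hsup, hneg, abs_eq_max_neg]
    rw [← hc]
    have h₁ : 0 ≤ (x ⊔ -x) - x := sub_nonneg.2 le_sup_left
    have h₂ : 0 ≤ (x ⊔ -x) + x := by
      rw [← sub_neg_eq_add]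
      exact sub_nonneg.2 le_sup_right
    generalize x ⊔ -x = c at h₁ h₂ ⊢
    have upper := hnonneg _ (add_nonneg (hmulpos _ _ h₁ hn') (hmulpos _ _ h₂ hn))
    have lower := hnonneg _ (add_nonneg (hmulpos _ _ h₁ hn) (hmulpos _ _ h₂ hn'))
    rw [show (c - x) * (n + b) + (c + x) * (n - b) =
      (n * c + n * c) + -(x * b + x * b) by ring, hadd, hneg, hadd, hadd, hnat] at upper
    rw [show (c - x) * (n - b) + (c + x) * (n + b) =
      (n * c + n * c) + (x * b + x * b) by ring, hadd, hadd, hadd, hnat] at lower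
    exact abs_le.2 ⟨by linarith, by linarith⟩
  have hshift : ∀ q : ℚ, |σ (a * b) - q * σ b| ≤ n * |σ a - q| := fun q => by
    have h := hbound (a + -(q • 1))
    rwa [add_mul, neg_mul, smul_mul_assoc, one_mul, hadd, hadd, hneg, hneg, hsmul, hsmul,
      hσone, mul_one, ← sub_eq_add_neg, ← sub_eq_add_neg] at h
  have hclosed : IsClosed {t : ℝ | |σ (a * b) - t * σ b| ≤ n * |σ a - t|} :=
    isClosed_le (by fun_prop) (by fun_prop)
  have hlimit : |σ (a * b) - σ a * σ b| ≤ n * |σ a - σ a| :=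
    Rat.denseRange_cast.induction_on
      (p := fun t : ℝ => |σ (a * b) - t * σ b| ≤ n * |σ a - t|) (σ a) hclosed hshift
  rw [sub_self, abs_zero, mul_zero] at hlimit
  exact sub_eq_zero.1 (abs_nonpos_iff.1 hlimit)
end

section
/- Let C := ℕ → Bool denote Cantor space with the product topology, and let C(C, ℝ) be the space of continuous real-valued functions on C with pointwise order and pointwise lattice operations. If σ : C(C, ℝ) → ℝ is a ℚ-linear map with σ(1) = 1 (where 1 is the constant function 1) and σ(f ⊔ g) = max(σ(f), σ(g)) for all f, g, then there exists a point x ∈ C such that σ(f) = f(x) for every f ∈ C(C, ℝ). -/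
namespace LatticeFunctional

variable {X : Type*} [TopologicalSpace X] {σ : C(X, ℝ) → ℝ}

theorem monotone_of_map_sup (hsup : ∀ f g, σ (f ⊔ g) = max (σ f) (σ g)) : Monotone σ := by
  intro f g hfg
  rw [← sup_eq_right.mpr hfg, hsup]
  exact le_max_left _ _

theorem map_const (hmono : Monotone σ) (hsmul : ∀ (q : ℚ) (f : C(X, ℝ)), σ (q • f) = q * σ f)
    (hone : σ 1 = 1) (c : ℝ) : σ (ContinuousMap.const X c) = c := by
  have hrat (q : ℚ) : σ (ContinuousMap.const X (q : ℝ)) = q := by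
    have h : ContinuousMap.const X (q : ℝ) = q • (1 : C(X, ℝ)) := by
      ext x
      simp [Rat.smul_def]
    rw [h, hsmul, hone, mul_one]
  apply le_antisymm
  · refine le_of_forall_lt_rat_imp_le fun q hq => ?_
    rw [← hrat q]
    exact hmono fun _ => hq.le
  · refine le_of_forall_rat_lt_imp_le fun q hq => ?_
    rw [← hrat q]
    exact hmono fun _ => hq.le

/-- A unital `ℚ`-linear lattice homomorphism `C(X, ℝ) → ℝ` on a compact space is the evaluation
at a point. -/
theorem exists_eq_eval [CompactSpace X]
    (hadd : ∀ f g, σ (f + g) = σ f + σ g)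
    (hsmul : ∀ (q : ℚ) (f : C(X, ℝ)), σ (q • f) = q * σ f)
    (hone : σ 1 = 1)
    (hsup : ∀ f g, σ (f ⊔ g) = max (σ f) (σ g)) :
    ∃ x, ∀ f : C(X, ℝ), σ f = f x := by
  have hmono := monotone_of_map_sup hsup
  have hconst := map_const hmono hsmul hone
  have hzero : σ 0 = 0 := hconst 0
  have hneg (f : C(X, ℝ)) : σ (-f) = -σ f := by
    have h := hadd f (-f)
    rw [add_neg_cancel, hzero] at h
    linarith
  by_contra! hne
  obtain ⟨g, hg, -, hpos⟩ : ∃ g : C(X, ℝ), σ g = 0 ∧ (∀ x, 0 ≤ g x) ∧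
      ∀ x ∈ (Set.univ : Set X), 0 < g x := by
    refine isCompact_univ.induction_on ⟨0, hzero, fun _ => le_rfl, by simp⟩ ?_ ?_ ?_
    · rintro s t hst ⟨g, hg, hg0, hgt⟩
      exact ⟨g, hg, hg0, fun x hx => hgt x (hst hx)⟩
    · rintro s t ⟨g, hg, hg0, hgs⟩ ⟨k, hk, hk0, hkt⟩
      refine ⟨g + k, by rw [hadd, hg, hk, add_zero], fun x => add_nonneg (hg0 x) (hk0 x), ?_⟩
      rintro x (hx | hx)
      · exact add_pos_of_pos_of_nonneg (hgs x hx) (hk0 x)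
      · exact add_pos_of_nonneg_of_pos (hg0 x) (hkt x hx)
    · intro x _
      obtain ⟨f, hf⟩ := hne x
      set k : C(X, ℝ) := f + -ContinuousMap.const X (σ f) with hk
      have hσk : σ k = 0 := by rw [hk, hadd, hneg, hconst, add_neg_cancel]
      have hval (y : X) : (k ⊔ -k) y = |k y| := rfl
      have hkx : k x ≠ 0 := by
        intro h
        apply hf
        simp only [hk, ContinuousMap.add_apply, ContinuousMap.neg_apply,
          ContinuousMap.const_apply] at h
        linarith
      refine ⟨{y | 0 < (k ⊔ -k) y}, mem_nhdsWithin_of_mem_nhds ?_, k ⊔ -k, ?_, ?_, fun y hy => hy⟩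
      · refine (isOpen_lt continuous_const (k ⊔ -k).continuous).mem_nhds ?_
        exact (abs_pos.mpr hkx).trans_eq (hval x).symm
      · rw [hsup, hneg, hσk, neg_zero, max_self]
      · exact fun y => (hval y).symm ▸ abs_nonneg _
  obtain ⟨c, hc, hle⟩ := isCompact_univ.exists_forall_le' g.continuous.continuousOn hpos
  have h : σ (ContinuousMap.const X c) ≤ σ g := hmono fun x => hle x trivial
  rw [hconst, hg] at h
  exact hc.not_ge h

end LatticeFunctional


/-- Let `C := ℕ → Bool` be Cantor space.  Every `ℚ`-linear map
`σ : C(C, ℝ) → ℝ` with `σ 1 = 1` that preserves binary (pointwise) suprema is given by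
evaluation at a point `x` of Cantor space: `σ f = f x` for all `f`. -/
theorem stone_yosida_stmt19 (σ : C((ℕ → Bool), ℝ) → ℝ)
    (hadd : ∀ f g : C((ℕ → Bool), ℝ), σ (f + g) = σ f + σ g)
    (hsmul : ∀ (q : ℚ) (f : C((ℕ → Bool), ℝ)), σ (q • f) = q * σ f)
    (hone : σ 1 = 1)
    (hsup : ∀ f g : C((ℕ → Bool), ℝ), σ (f ⊔ g) = max (σ f) (σ g)) :
    ∃ x : ℕ → Bool, ∀ f : C((ℕ → Bool), ℝ), σ f = f x := by
  exact LatticeFunctional.exists_eq_eval hadd hsmul hone hsup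
end
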